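/- For every ε > 0 there exists a constant C > 0 (depending only on ε and on γ) such that for every positive integer m which is a sum of two squares, | ∫₀ᴸ ∫₀ᴸ ( r₁(t₁,t₂) / (2π√m) )² dt₁ dt₂ − L²/(2N) | ≤ C · N^{ε−2}, where N = #{μ ∈ ℤ² : μ₁² + μ₂² = m} and r₁ = ∂r/∂t₁. -/

import Mathlib

open MeasureTheory ProbabilityTheory Real

noncomputable section

/-- The set of lattice points on the circle of radius `√m`:
`E = {μ ∈ ℤ² : μ₁² + μ₂² = m}` (all solutions satisfy `|μᵢ| ≤ m`). -/
def latticeSet (m : ℕ) : Finset (ℤ × ℤ) :=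
  (Finset.Icc (-(m : ℤ)) (m : ℤ) ×ˢ Finset.Icc (-(m : ℤ)) (m : ℤ)).filter
    (fun μ => μ.1 ^ 2 + μ.2 ^ 2 = (m : ℤ))

/-- `N = #E`, the number of lattice points on the circle of radius `√m`. -/
def latN (m : ℕ) : ℕ := (latticeSet m).card

/-- The covariance function of the wave restricted to the curve:
`r(t₁,t₂) = N⁻¹ ∑_{μ ∈ E} cos(2π⟨μ, γ(t₁) − γ(t₂)⟩)`. -/
def covFn (m : ℕ) (γ : ℝ → ℝ × ℝ) (t₁ t₂ : ℝ) : ℝ :=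
  ((latN m : ℝ))⁻¹ *
    ∑ μ ∈ latticeSet m,
      Real.cos (2 * π * ((μ.1 : ℝ) * (γ t₁ - γ t₂).1 + (μ.2 : ℝ) * (γ t₁ - γ t₂).2))

/-- `r₁ = ∂r/∂t₁`. -/
def covFn1 (m : ℕ) (γ : ℝ → ℝ × ℝ) (t₁ t₂ : ℝ) : ℝ :=
  deriv (fun s => covFn m γ s t₂) t₁

/-- `r₂ = ∂r/∂t₂`. -/
def covFn2 (m : ℕ) (γ : ℝ → ℝ × ℝ) (t₁ t₂ : ℝ) : ℝ :=
  deriv (fun s => covFn m γ t₁ s) t₂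

/-- `r₁₂ = ∂²r/∂t₁∂t₂`. -/
def covFn12 (m : ℕ) (γ : ℝ → ℝ × ℝ) (t₁ t₂ : ℝ) : ℝ :=
  deriv (fun s => deriv (fun u => covFn m γ s u) t₂) t₁

/-- For `q = p'` with `q² ≥ c (1 - p²)`, the integral of `1 / (p² + δ²)` is `O(1 / δ)`. -/
lemma integral_inv_sq_add_sq_le {L c K δ : ℝ} (hL : 0 < L) (hc : 0 < c) (hδ : 0 < δ)
    (hδ1 : δ ≤ 1) {p q s : ℝ → ℝ} (hp : ∀ t, HasDerivAt p (q t) t)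
    (hq : ∀ t, HasDerivAt q (s t) t) (hs : Continuous s)
    (hqK : ∀ t ∈ Set.Icc 0 L, |q t| ≤ K) (hsK : ∀ t ∈ Set.Icc 0 L, |s t| ≤ K)
    (hpq : ∀ t ∈ Set.Icc 0 L, c * (1 - p t ^ 2) ≤ q t ^ 2) :
    ∫ t in (0:ℝ)..L, (p t ^ 2 + δ ^ 2)⁻¹ ≤ (K * π + L * (K * (π / 2) + c)) / c / δ := by
  have hpc : Continuous p := continuous_iff_continuousAt.2 fun t => (hp t).continuousAt
  have hqc : Continuous q := continuous_iff_continuousAt.2 fun t => (hq t).continuousAt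
  have hpos : ∀ t, 0 < p t ^ 2 + δ ^ 2 := fun t => by positivity
  have hne : ∀ t, p t ^ 2 + δ ^ 2 ≠ 0 := fun t => (hpos t).ne'
  have harctan : ∀ x, |Real.arctan x| ≤ π / 2 := fun x => by
    rw [abs_le]
    exact ⟨(Real.neg_pi_div_two_lt_arctan x).le, (Real.arctan_lt_pi_div_two x).le⟩
  have hK : 0 ≤ K := (abs_nonneg _).trans (hqK 0 ⟨le_rfl, hL.le⟩)
  set F : ℝ → ℝ := fun t => q t * Real.arctan (p t / δ) with hF
  set F' : ℝ → ℝ := fun t => s t * Real.arctan (p t / δ) + q t ^ 2 * δ * (p t ^ 2 + δ ^ 2)⁻¹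
    with hF'
  have hder : ∀ t, HasDerivAt F (F' t) t := fun t => by
    have h := (hq t).mul (((hp t).div_const δ).arctan)
    refine HasDerivAt.congr_deriv h ?_
    simp only [hF']
    have h1 := hne t
    have h2 : 1 + (p t / δ) ^ 2 ≠ 0 := by positivity
    field_simp
    ring
  have hF'c : Continuous F' := by
    have : Continuous fun t => (p t ^ 2 + δ ^ 2)⁻¹ :=
      Continuous.inv₀ (by fun_prop) hne
    have h2 : Continuous fun t => Real.arctan (p t / δ) :=
      Real.continuous_arctan.comp (by fun_prop)
    simp only [hF']
    fun_prop
  have hFTC : ∫ t in (0:ℝ)..L, F' t = F L - F 0 :=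
    intervalIntegral.integral_eq_sub_of_hasDerivAt (fun t _ => hder t)
      (hF'c.intervalIntegrable _ _)
  have hFb : ∀ t ∈ Set.Icc 0 L, |F t| ≤ K * (π / 2) := fun t ht => by
    simp only [hF, abs_mul]
    exact mul_le_mul (hqK t ht) (harctan _) (abs_nonneg _) hK
  have hwc : Continuous fun t => (p t ^ 2 + δ ^ 2)⁻¹ := Continuous.inv₀ (by fun_prop) hne
  have hmono : ∫ t in (0:ℝ)..L, c * δ * (p t ^ 2 + δ ^ 2)⁻¹ ≤
      ∫ t in (0:ℝ)..L, (F' t + (K * (π / 2) + c)) := by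
    refine intervalIntegral.integral_mono_on hL.le ((hwc.const_mul _).intervalIntegrable _ _)
      ((hF'c.add continuous_const).intervalIntegrable _ _) fun t ht => ?_
    have h1 : |s t * Real.arctan (p t / δ)| ≤ K * (π / 2) := by
      rw [abs_mul]
      exact mul_le_mul (hsK t ht) (harctan _) (abs_nonneg _) hK
    have h2 := (abs_le.1 h1).1
    have hw : 0 < (p t ^ 2 + δ ^ 2)⁻¹ := inv_pos.2 (hpos t)
    have h3 : p t ^ 2 * (p t ^ 2 + δ ^ 2)⁻¹ ≤ 1 := by
      rw [← div_eq_mul_inv, div_le_one (hpos t)]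
      nlinarith [sq_nonneg δ]
    have h4 := mul_le_mul_of_nonneg_right (hpq t ht) (mul_pos hδ hw).le
    have h5 : c * δ * (p t ^ 2 * (p t ^ 2 + δ ^ 2)⁻¹) ≤ c * δ * 1 :=
      mul_le_mul_of_nonneg_left h3 (by positivity)
    have h6 : c * δ ≤ c * 1 := mul_le_mul_of_nonneg_left hδ1 hc.le
    simp only [hF']
    nlinarith
  rw [intervalIntegral.integral_const_mul, intervalIntegral.integral_add
    (hF'c.intervalIntegrable _ _) (continuous_const.intervalIntegrable _ _), hFTC,
    intervalIntegral.integral_const, smul_eq_mul, sub_zero] at hmono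
  have h1 := (abs_le.1 (hFb L ⟨hL.le, le_rfl⟩)).2
  have h2 := (abs_le.1 (hFb 0 ⟨le_rfl, hL.le⟩)).1
  rw [div_div, le_div_iff₀ (by positivity)]
  nlinarith

/-- A van der Corput estimate: oscillatory integrals whose phase `φ` has no degenerate critical
points are `O(δ)` at frequency `1 / δ²`. -/
lemma abs_integral_oscillatory_le {L c K δ : ℝ} (hL : 0 < L) (hc : 0 < c) (hδ : 0 < δ)
    (hδ1 : δ ≤ 1) {φ p q s a a' g G : ℝ → ℝ} (hφ : ∀ t, HasDerivAt φ (p t) t)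
    (hp : ∀ t, HasDerivAt p (q t) t)
    (hq : ∀ t, HasDerivAt q (s t) t) (hs : Continuous s)
    (ha : ∀ t, HasDerivAt a (a' t) t) (ha' : Continuous a')
    (hG : ∀ x, HasDerivAt G (g x) x) (hg : Continuous g)
    (hg1 : ∀ x, |g x| ≤ 1) (hG1 : ∀ x, |G x| ≤ 1)
    (hqK : ∀ t ∈ Set.Icc 0 L, |q t| ≤ K) (hsK : ∀ t ∈ Set.Icc 0 L, |s t| ≤ K)
    (haK : ∀ t ∈ Set.Icc 0 L, |a t| ≤ 1) (ha'K : ∀ t ∈ Set.Icc 0 L, |a' t| ≤ K)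
    (hpq : ∀ t ∈ Set.Icc 0 L, c * (1 - p t ^ 2) ≤ q t ^ 2) :
    |∫ t in (0:ℝ)..L, a t * g (φ t / δ ^ 2)| ≤
      (2 + L * K + (3 * K + 1) * ((K * π + L * (K * (π / 2) + c)) / c)) * δ := by
  have hI := integral_inv_sq_add_sq_le hL hc hδ hδ1 hp hq hs hqK hsK hpq
  set B := (K * π + L * (K * (π / 2) + c)) / c with hB
  have hφc : Continuous φ := continuous_iff_continuousAt.2 fun t => (hφ t).continuousAt
  have hpc : Continuous p := continuous_iff_continuousAt.2 fun t => (hp t).continuousAt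
  have hqc : Continuous q := continuous_iff_continuousAt.2 fun t => (hq t).continuousAt
  have hac : Continuous a := continuous_iff_continuousAt.2 fun t => (ha t).continuousAt
  have hGc : Continuous G := continuous_iff_continuousAt.2 fun t => (hG t).continuousAt
  have hpos : ∀ t, 0 < p t ^ 2 + δ ^ 2 := fun t => by positivity
  have hne : ∀ t, p t ^ 2 + δ ^ 2 ≠ 0 := fun t => (hpos t).ne'
  have hK : 0 ≤ K := (abs_nonneg _).trans (hqK 0 ⟨le_rfl, hL.le⟩)
  set w : ℝ → ℝ := fun t => (p t ^ 2 + δ ^ 2)⁻¹ with hw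
  have hwpos : ∀ t, 0 < w t := fun t => inv_pos.2 (hpos t)
  have hwc : Continuous w := Continuous.inv₀ (by fun_prop) hne
  have hw' : ∀ t, HasDerivAt w (-(2 * p t * q t) * w t ^ 2) t := fun t => by
    have h := (((hp t).pow 2).add_const (δ ^ 2)).inv (hne t)
    refine HasDerivAt.congr_deriv h ?_
    simp only [hw]
    have h1 := hne t
    simp only [Pi.pow_apply]
    push_cast
    field_simp
  have hgc : Continuous fun t => g (φ t / δ ^ 2) := hg.comp (by fun_prop)
  have hGc' : Continuous fun t => G (φ t / δ ^ 2) := hGc.comp (by fun_prop)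
  set D : ℝ → ℝ := fun t => a' t * p t * w t + a t * q t * w t +
    a t * p t * (-(2 * p t * q t) * w t ^ 2) with hD
  have hDc : Continuous D := by simp only [hD]; fun_prop
  set H : ℝ → ℝ := fun t => a t * p t * w t * G (φ t / δ ^ 2) with hH
  have hder : ∀ t, HasDerivAt H (D t * G (φ t / δ ^ 2) +
      (a t * g (φ t / δ ^ 2) / δ ^ 2 - a t * g (φ t / δ ^ 2) * w t)) t := fun t => by
    have hGφ : HasDerivAt (fun t => G (φ t / δ ^ 2)) (g (φ t / δ ^ 2) * (p t / δ ^ 2)) t :=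
      (hG (φ t / δ ^ 2)).comp t ((hφ t).div_const _)
    have h := (((ha t).mul (hp t)).mul (hw' t)).mul hGφ
    refine HasDerivAt.congr_deriv h ?_
    have h1 : p t ^ 2 * w t = 1 - δ ^ 2 * w t := by
      simp only [hw]
      have h1 := hne t
      field_simp
      ring
    have h2 : a t * p t * w t * (g (φ t / δ ^ 2) * (p t / δ ^ 2)) =
        a t * g (φ t / δ ^ 2) / δ ^ 2 - a t * g (φ t / δ ^ 2) * w t := by
      calc _ = a t * g (φ t / δ ^ 2) / δ ^ 2 * (p t ^ 2 * w t) := by ring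
        _ = _ := by rw [h1]; field_simp
    simp only [hD, Pi.mul_apply]
    rw [h2]
    ring
  have hFTC := intervalIntegral.integral_eq_sub_of_hasDerivAt (a := 0) (b := L)
    (fun t _ => hder t) (Continuous.intervalIntegrable (by fun_prop) _ _)
  rw [intervalIntegral.integral_add (Continuous.intervalIntegrable (by fun_prop) _ _)
    (Continuous.intervalIntegrable (by fun_prop) _ _), intervalIntegral.integral_sub
    (Continuous.intervalIntegrable (by fun_prop) _ _)
    (Continuous.intervalIntegrable (by fun_prop) _ _),
    intervalIntegral.integral_div] at hFTC
  have hpw : ∀ t, |p t| * w t ≤ 1 / δ := fun t => by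
    simp only [hw]
    rw [← div_eq_mul_inv, div_le_div_iff₀ (hpos t) hδ]
    nlinarith [sq_nonneg (|p t| - δ), sq_abs (p t), abs_nonneg (p t)]
  have hppw : ∀ t, p t ^ 2 * w t ≤ 1 := fun t => by
    simp only [hw]
    rw [← div_eq_mul_inv, div_le_one (hpos t)]
    nlinarith [sq_nonneg δ]
  have hHb : ∀ t ∈ Set.Icc 0 L, |H t| ≤ 1 / δ := fun t ht => by
    simp only [hH, abs_mul, abs_of_pos (hwpos t)]
    calc |a t| * |p t| * w t * |G (φ t / δ ^ 2)| ≤ 1 * (1 / δ) * 1 := by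
          rw [mul_assoc |a t|]
          have := hwpos t
          refine mul_le_mul (mul_le_mul (haK t ht) (hpw t) (by positivity) zero_le_one)
            (hG1 _) (abs_nonneg _) (by positivity)
      _ = 1 / δ := by ring
  have hDb : ∀ t ∈ Set.Icc 0 L, |D t * G (φ t / δ ^ 2)| ≤ K / δ + 3 * K * w t := fun t ht => by
    have hw0 := (hwpos t).le
    have e1 : |a' t * p t * w t| ≤ K * (1 / δ) := by
      rw [mul_assoc, abs_mul, abs_mul (p t), abs_of_pos (hwpos t)]
      exact mul_le_mul (ha'K t ht) (hpw t) (by positivity) hK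
    have e2 : |a t * q t * w t| ≤ 1 * K * w t := by
      rw [abs_mul, abs_mul, abs_of_pos (hwpos t)]
      exact mul_le_mul_of_nonneg_right
        (mul_le_mul (haK t ht) (hqK t ht) (abs_nonneg _) zero_le_one) hw0
    have e3 : |a t * p t * (-(2 * p t * q t) * w t ^ 2)| ≤ 2 * K * w t := by
      have : a t * p t * (-(2 * p t * q t) * w t ^ 2) =
        -(2 * (a t * q t * w t) * (p t ^ 2 * w t)) := by ring
      rw [this, abs_neg, abs_mul, abs_mul, abs_two,
        abs_of_nonneg (mul_nonneg (sq_nonneg (p t)) hw0)]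
      calc 2 * |a t * q t * w t| * (p t ^ 2 * w t) ≤ 2 * (1 * K * w t) * 1 :=
            mul_le_mul (by linarith) (hppw t) (by positivity) (by positivity)
        _ = _ := by ring
    have e4 : |D t| ≤ K / δ + 3 * K * w t := by
      simp only [hD]
      refine (abs_add_le _ _).trans ?_
      have := abs_add_le (a' t * p t * w t) (a t * q t * w t)
      have : K / δ = K * (1 / δ) := by ring
      linarith
    rw [abs_mul]
    calc _ ≤ |D t| * 1 := mul_le_mul_of_nonneg_left (hG1 _) (abs_nonneg _)
      _ ≤ _ := by linarith
  have hDI : |∫ t in (0:ℝ)..L, D t * G (φ t / δ ^ 2)| ≤ L * (K / δ) + 3 * K * (B / δ) := by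
    refine (intervalIntegral.abs_integral_le_integral_abs hL.le).trans ?_
    refine (intervalIntegral.integral_mono_on hL.le
      (Continuous.intervalIntegrable (by fun_prop) _ _)
      (Continuous.intervalIntegrable (by fun_prop) _ _) hDb).trans ?_
    rw [intervalIntegral.integral_add (Continuous.intervalIntegrable (by fun_prop) _ _)
      (Continuous.intervalIntegrable (by fun_prop) _ _), intervalIntegral.integral_const,
      intervalIntegral.integral_const_mul, smul_eq_mul, sub_zero]
    have := mul_le_mul_of_nonneg_left hI (by positivity : 0 ≤ 3 * K)
    linarith
  have hwI : |∫ t in (0:ℝ)..L, a t * g (φ t / δ ^ 2) * w t| ≤ B / δ := by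
    refine (intervalIntegral.abs_integral_le_integral_abs hL.le).trans
      ((intervalIntegral.integral_mono_on hL.le
      (Continuous.intervalIntegrable (by fun_prop) _ _)
      (Continuous.intervalIntegrable (by fun_prop) _ _) fun t ht => ?_).trans hI)
    rw [abs_mul, abs_mul, abs_of_pos (hwpos t)]
    calc _ ≤ 1 * 1 * w t := mul_le_mul_of_nonneg_right
          (mul_le_mul (haK t ht) (hg1 _) (abs_nonneg _) zero_le_one) (hwpos t).le
      _ = _ := by ring
  set J := ∫ t in (0:ℝ)..L, a t * g (φ t / δ ^ 2) with hJ
  have hJ' : |J / δ ^ 2| ≤ (2 + L * K + (3 * K + 1) * B) / δ := by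
    have e : J / δ ^ 2 = (H L - H 0) + (∫ t in (0:ℝ)..L, a t * g (φ t / δ ^ 2) * w t) -
      ∫ t in (0:ℝ)..L, D t * G (φ t / δ ^ 2) := by linarith
    have h1 := abs_le.1 (hHb L ⟨hL.le, le_rfl⟩)
    have h2 := abs_le.1 (hHb 0 ⟨le_rfl, hL.le⟩)
    have h3 := abs_le.1 hDI
    have h4 := abs_le.1 hwI
    have e2 : (2 + L * K + (3 * K + 1) * B) / δ =
      1 / δ + 1 / δ + L * (K / δ) + 3 * K * (B / δ) + B / δ := by ring
    rw [e, e2, abs_le]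
    constructor <;> linarith
  rw [abs_div, abs_of_pos (by positivity : 0 < δ ^ 2), div_le_div_iff₀ (by positivity) hδ] at hJ'
  refine le_of_mul_le_mul_right (hJ'.trans_eq ?_) hδ
  ring

/-- If `v` is a unit vector orthogonal to `w`, and `u` is a unit vector, then the component of
`u` orthogonal to `v` is controlled by `⟨u, w⟩`. -/
lemma mul_one_sub_inner_sq_le {a b x y X Y c : ℝ} (hu : a ^ 2 + b ^ 2 = 1)
    (n : x ^ 2 + y ^ 2 = 1) (o : x * X + y * Y = 0) (m : c ≤ X ^ 2 + Y ^ 2) :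
    c * (1 - (a * x + b * y) ^ 2) ≤ (a * X + b * Y) ^ 2 := by
  obtain ⟨κ, hκ⟩ : ∃ κ, κ = x * Y - y * X := ⟨_, rfl⟩
  have eX : X = -κ * y := by rw [hκ]; linear_combination X * (-n) + x * o
  have eY : Y = κ * x := by rw [hκ]; linear_combination Y * (-n) + y * o
  clear hκ
  subst eX eY
  have e1 : 1 - (a * x + b * y) ^ 2 = (b * x - a * y) ^ 2 := by
    linear_combination (-hu) * (x ^ 2 + y ^ 2) - n
  have e2 : (-κ * y) ^ 2 + (κ * x) ^ 2 = κ ^ 2 := by linear_combination κ ^ 2 * n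
  have e3 : (a * (-κ * y) + b * (κ * x)) ^ 2 = κ ^ 2 * (b * x - a * y) ^ 2 := by ring
  rw [e1, e3]
  exact mul_le_mul_of_nonneg_right (m.trans_eq e2) (sq_nonneg _)

/-- For a unit-speed curve the second derivative is orthogonal to the first. -/
lemma deriv_inner_deriv_deriv_eq_zero {L : ℝ} (hL : 0 < L) {γ : ℝ → ℝ × ℝ}
    (hγ : ContDiff ℝ (⊤ : ℕ∞) γ)
    (hunit : ∀ t ∈ Set.Icc (0:ℝ) L, (deriv γ t).1 ^ 2 + (deriv γ t).2 ^ 2 = 1) :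
    ∀ t ∈ Set.Icc (0:ℝ) L,
      (deriv γ t).1 * (deriv (deriv γ) t).1 + (deriv γ t).2 * (deriv (deriv γ) t).2 = 0 := by
  have h1 : ContDiff ℝ (⊤ : ℕ∞) (deriv γ) := (contDiff_infty_iff_deriv.1 hγ).2
  have h2 : ContDiff ℝ (⊤ : ℕ∞) (deriv (deriv γ)) := (contDiff_infty_iff_deriv.1 h1).2
  have hc1 := h1.continuous
  have hc2 := h2.continuous
  have hd : ∀ t, HasDerivAt (deriv γ) (deriv (deriv γ) t) t := fun t =>
    ((contDiff_infty_iff_deriv.1 h1).1 t).hasDerivAt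
  have hIoo : Set.Ioo (0:ℝ) L ⊆ {t | (deriv γ t).1 * (deriv (deriv γ) t).1 +
      (deriv γ t).2 * (deriv (deriv γ) t).2 = 0} := fun t ht => by
    have hx : HasDerivAt (fun t => (deriv γ t).1) (deriv (deriv γ) t).1 t := (hd t).fst
    have hy : HasDerivAt (fun t => (deriv γ t).2) (deriv (deriv γ) t).2 t := (hd t).snd
    have h := (hx.pow 2).add (hy.pow 2)
    have h' : HasDerivAt ((fun t => (deriv γ t).1) ^ 2 + (fun t => (deriv γ t).2) ^ 2) 0 t := by
      refine (hasDerivAt_const t (1:ℝ)).congr_of_eventuallyEq ?_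
      filter_upwards [Ioo_mem_nhds ht.1 ht.2] with r hr
      exact hunit r ⟨hr.1.le, hr.2.le⟩
    have := h.unique h'
    push_cast at this
    simp only [pow_one] at this
    change _ = _
    linarith
  have hclosed : IsClosed {t | (deriv γ t).1 * (deriv (deriv γ) t).1 +
      (deriv γ t).2 * (deriv (deriv γ) t).2 = 0} :=
    isClosed_eq (by fun_prop) continuous_const
  intro t ht
  rw [← closure_Ioo hL.ne] at ht
  exact closure_minimal hIoo hclosed ht

/-- Oscillatory integrals along a curve with nowhere vanishing curvature, at frequency `ξ`,
decay like `|ξ|^{-1/2}`; this is the resulting bound for the double integral. -/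
lemma exists_abs_integral_curve_le {L : ℝ} (hL : 0 < L) {γ : ℝ → ℝ × ℝ}
    (hγ : ContDiff ℝ (⊤ : ℕ∞) γ)
    (hunit : ∀ t ∈ Set.Icc (0:ℝ) L, (deriv γ t).1 ^ 2 + (deriv γ t).2 ^ 2 = 1)
    (hcurv : ∀ t ∈ Set.Icc (0:ℝ) L, deriv (deriv γ) t ≠ 0) :
    ∃ C > 0, ∀ ξ : ℤ × ℤ, ξ ≠ 0 → ∀ e f : ℝ × ℝ, e.1 ^ 2 + e.2 ^ 2 ≤ 1 →
      f.1 ^ 2 + f.2 ^ 2 ≤ 1 →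
      |∫ t₁ in (0:ℝ)..L, ∫ t₂ in (0:ℝ)..L,
        (e.1 * (deriv γ t₁).1 + e.2 * (deriv γ t₁).2) *
        (f.1 * (deriv γ t₁).1 + f.2 * (deriv γ t₁).2) *
        Real.cos (2 * π * ((ξ.1 : ℝ) * (γ t₁).1 + ξ.2 * (γ t₁).2) -
          2 * π * ((ξ.1 : ℝ) * (γ t₂).1 + ξ.2 * (γ t₂).2))| ≤
      C / √((ξ.1 : ℝ) ^ 2 + (ξ.2 : ℝ) ^ 2) := by
  have h1 : ContDiff ℝ (⊤ : ℕ∞) (deriv γ) := (contDiff_infty_iff_deriv.1 hγ).2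
  have h2 : ContDiff ℝ (⊤ : ℕ∞) (deriv (deriv γ)) := (contDiff_infty_iff_deriv.1 h1).2
  have h3 : ContDiff ℝ (⊤ : ℕ∞) (deriv (deriv (deriv γ))) := (contDiff_infty_iff_deriv.1 h2).2
  have d0 : ∀ t, HasDerivAt γ (deriv γ t) t := fun t =>
    ((contDiff_infty_iff_deriv.1 hγ).1 t).hasDerivAt
  have d1 : ∀ t, HasDerivAt (deriv γ) (deriv (deriv γ) t) t := fun t =>
    ((contDiff_infty_iff_deriv.1 h1).1 t).hasDerivAt
  have d2 : ∀ t, HasDerivAt (deriv (deriv γ)) (deriv (deriv (deriv γ)) t) t := fun t =>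
    ((contDiff_infty_iff_deriv.1 h2).1 t).hasDerivAt
  have horth := deriv_inner_deriv_deriv_eq_zero hL hγ hunit
  have hc0 := hγ.continuous
  have hc1 := h1.continuous
  have hc2 := h2.continuous
  have hc3 := h3.continuous
  set γ₁ := deriv γ
  set γ₂ := deriv γ₁
  set γ₃ := deriv γ₂
  have hlin : ∀ (v : ℝ × ℝ) {β β' : ℝ → ℝ × ℝ}, (∀ t, HasDerivAt β (β' t) t) →
      ∀ t, HasDerivAt (fun t => v.1 * (β t).1 + v.2 * (β t).2)
        (v.1 * (β' t).1 + v.2 * (β' t).2) t := fun v β β' h t => by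
    have hx : HasDerivAt (fun t => (β t).1) (β' t).1 t := (h t).fst
    have hy : HasDerivAt (fun t => (β t).2) (β' t).2 t := (h t).snd
    exact (hx.const_mul v.1).add (hy.const_mul v.2)
  have hcs : ∀ v w : ℝ × ℝ, v.1 ^ 2 + v.2 ^ 2 ≤ 1 → w.1 ^ 2 + w.2 ^ 2 = 1 →
      |v.1 * w.1 + v.2 * w.2| ≤ 1 := fun v w hv hw => by
    rw [abs_le_one_iff_mul_self_le_one]
    nlinarith [sq_nonneg (v.1 * w.2 - v.2 * w.1)]
  have hsup : ∀ v w : ℝ × ℝ, v.1 ^ 2 + v.2 ^ 2 ≤ 1 → |v.1 * w.1 + v.2 * w.2| ≤ 2 * ‖w‖ :=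
    fun v w hv => by
    have hv1 : |v.1| ≤ 1 := abs_le_one_iff_mul_self_le_one.2 (by nlinarith [sq_nonneg v.2])
    have hv2 : |v.2| ≤ 1 := abs_le_one_iff_mul_self_le_one.2 (by nlinarith [sq_nonneg v.1])
    have hw1 : |w.1| ≤ ‖w‖ := norm_fst_le w
    have hw2 : |w.2| ≤ ‖w‖ := norm_snd_le w
    have e1 : |v.1| * |w.1| ≤ 1 * ‖w‖ := mul_le_mul hv1 hw1 (abs_nonneg _) zero_le_one
    have e2 : |v.2| * |w.2| ≤ 1 * ‖w‖ := mul_le_mul hv2 hw2 (abs_nonneg _) zero_le_one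
    have := abs_add_le (v.1 * w.1) (v.2 * w.2)
    rw [abs_mul, abs_mul] at this
    linarith
  obtain ⟨M₂, hM₂⟩ := isCompact_Icc.exists_bound_of_continuousOn
    (hc2.continuousOn (s := Set.Icc 0 L))
  obtain ⟨M₃, hM₃⟩ := isCompact_Icc.exists_bound_of_continuousOn
    (hc3.continuousOn (s := Set.Icc 0 L))
  obtain ⟨c, hc, hcle⟩ : ∃ c > 0, ∀ t ∈ Set.Icc 0 L, c ≤ (γ₂ t).1 ^ 2 + (γ₂ t).2 ^ 2 := by
    obtain ⟨t₀, ht₀, hmin⟩ := isCompact_Icc.exists_isMinOn ⟨0, le_rfl, hL.le⟩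
      (Continuous.continuousOn (s := Set.Icc 0 L)
        (by fun_prop : Continuous fun t => (γ₂ t).1 ^ 2 + (γ₂ t).2 ^ 2))
    refine ⟨_, ?_, hmin⟩
    have hne := hcurv t₀ ht₀
    by_contra hle
    have e1 : (γ₂ t₀).1 = 0 := by nlinarith [sq_nonneg (γ₂ t₀).1, sq_nonneg (γ₂ t₀).2]
    have e2 : (γ₂ t₀).2 = 0 := by nlinarith [sq_nonneg (γ₂ t₀).1, sq_nonneg (γ₂ t₀).2]
    exact hne (Prod.ext e1 e2)
  set K := 4 * max M₂ M₃ with hK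
  have hM₂0 : 0 ≤ M₂ := (norm_nonneg _).trans (hM₂ 0 ⟨le_rfl, hL.le⟩)
  have hM₂K : 4 * M₂ ≤ K := by simp [hK]
  have hM₃K : 4 * M₃ ≤ K := by simp [hK]
  have hK0 : 0 ≤ K := by linarith
  set C := 2 + L * K + (3 * K + 1) * ((K * π + L * (K * (π / 2) + c)) / c) with hC
  have hCpos : 0 < C := by positivity
  refine ⟨2 * C ^ 2, by positivity, fun ξ hξ e f he hf => ?_⟩
  set R := √((ξ.1 : ℝ) ^ 2 + (ξ.2 : ℝ) ^ 2) with hR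
  have hR2 : R ^ 2 = (ξ.1 : ℝ) ^ 2 + (ξ.2 : ℝ) ^ 2 := Real.sq_sqrt (by positivity)
  have hR1 : 1 ≤ R := by
    rw [hR, Real.one_le_sqrt]
    have : 1 ≤ ξ.1 ^ 2 + ξ.2 ^ 2 := by
      by_contra hlt
      have e1 : ξ.1 = 0 := by nlinarith [sq_nonneg ξ.1, sq_nonneg ξ.2]
      have e2 : ξ.2 = 0 := by nlinarith [sq_nonneg ξ.1, sq_nonneg ξ.2]
      exact hξ (Prod.ext e1 e2)
    exact_mod_cast this
  have hR0 : 0 < R := by linarith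
  set δ := (√(2 * π * R))⁻¹ with hδ
  have h2πR : 1 ≤ 2 * π * R := by nlinarith [Real.pi_gt_three]
  have hδ0 : 0 < δ := by positivity
  have hδ1 : δ ≤ 1 := inv_le_one_of_one_le₀ (Real.one_le_sqrt.2 h2πR)
  have hδ2 : δ ^ 2 = (2 * π * R)⁻¹ := by rw [hδ, inv_pow, Real.sq_sqrt (by positivity)]
  set u : ℝ × ℝ := (ξ.1 / R, ξ.2 / R) with hu
  have hu1 : u.1 ^ 2 + u.2 ^ 2 = 1 := by
    simp only [hu, div_pow]
    rw [← add_div, ← hR2, div_self (by positivity)]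
  set φ : ℝ → ℝ := fun t => u.1 * (γ t).1 + u.2 * (γ t).2 with hφ
  have hφδ : ∀ t, 2 * π * ((ξ.1 : ℝ) * (γ t).1 + ξ.2 * (γ t).2) = φ t / δ ^ 2 := fun t => by
    rw [hδ2, hφ, hu]
    field_simp
  have hpq : ∀ t ∈ Set.Icc 0 L, c * (1 - (u.1 * (γ₁ t).1 + u.2 * (γ₁ t).2) ^ 2) ≤
      (u.1 * (γ₂ t).1 + u.2 * (γ₂ t).2) ^ 2 := fun t ht => by
    have o := horth t ht
    have n := hunit t ht
    have m := hcle t ht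
    exact mul_one_sub_inner_sq_le hu1 n o m
  have key : ∀ (a a' g G : ℝ → ℝ), (∀ t, HasDerivAt a (a' t) t) → Continuous a' →
      (∀ x, HasDerivAt G (g x) x) → Continuous g → (∀ x, |g x| ≤ 1) → (∀ x, |G x| ≤ 1) →
      (∀ t ∈ Set.Icc 0 L, |a t| ≤ 1) → (∀ t ∈ Set.Icc 0 L, |a' t| ≤ K) →
      |∫ t in (0:ℝ)..L, a t * g (φ t / δ ^ 2)| ≤ C * δ := by
    intro a a' g G ha ha' hG hg hg1 hG1 haK ha'K
    refine abs_integral_oscillatory_le hL hc hδ0 hδ1 (hlin u d0) (hlin u d1) (hlin u d2)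
      (by fun_prop) ha ha' hG hg hg1 hG1 (fun t ht => ?_) (fun t ht => ?_) haK ha'K hpq
    · have := hM₂ t ht
      exact (hsup u (γ₂ t) hu1.le).trans (by linarith)
    · have := hM₃ t ht
      have := (norm_nonneg _).trans this
      exact (hsup u (γ₃ t) hu1.le).trans (by linarith)
  set a : ℝ → ℝ := fun t => (e.1 * (γ₁ t).1 + e.2 * (γ₁ t).2) *
    (f.1 * (γ₁ t).1 + f.2 * (γ₁ t).2) with ha
  set a' : ℝ → ℝ := fun t => (e.1 * (γ₂ t).1 + e.2 * (γ₂ t).2) *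
    (f.1 * (γ₁ t).1 + f.2 * (γ₁ t).2) + (e.1 * (γ₁ t).1 + e.2 * (γ₁ t).2) *
    (f.1 * (γ₂ t).1 + f.2 * (γ₂ t).2) with ha'
  have had : ∀ t, HasDerivAt a (a' t) t := fun t => (hlin e d1 t).mul (hlin f d1 t)
  have hac : Continuous a := by simp only [ha]; fun_prop
  have ha'c : Continuous a' := by simp only [ha']; fun_prop
  have haK : ∀ t ∈ Set.Icc 0 L, |a t| ≤ 1 := fun t ht => by
    simp only [ha, abs_mul]
    exact mul_le_one₀ (hcs e _ he (hunit t ht)) (abs_nonneg _) (hcs f _ hf (hunit t ht))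
  have ha'K : ∀ t ∈ Set.Icc 0 L, |a' t| ≤ K := fun t ht => by
    have := hM₂ t ht
    have b1 := mul_le_mul (hsup e (γ₂ t) he) (hcs f _ hf (hunit t ht)) (abs_nonneg _)
      (by positivity)
    have b2 := mul_le_mul (hcs e _ he (hunit t ht)) (hsup f (γ₂ t) hf) (abs_nonneg _)
      zero_le_one
    rw [← abs_mul] at b1 b2
    exact (abs_add_le _ _).trans (by linarith)
  have hcosG : ∀ x, HasDerivAt Real.sin (Real.cos x) x := Real.hasDerivAt_sin
  have hsinG : ∀ x, HasDerivAt (fun x => -Real.cos x) (Real.sin x) x := fun x => by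
    simpa using (Real.hasDerivAt_cos x).fun_neg
  have hnegcos : ∀ x, |-Real.cos x| ≤ 1 := fun x => by
    rw [abs_neg]; exact Real.abs_cos_le_one x
  have k1 := key a a' _ _ had ha'c hcosG Real.continuous_cos Real.abs_cos_le_one
    Real.abs_sin_le_one haK ha'K
  have k2 := key a a' _ _ had ha'c hsinG Real.continuous_sin Real.abs_sin_le_one
    hnegcos haK ha'K
  have k3 := key (fun _ => 1) (fun _ => 0) _ _ (fun t => hasDerivAt_const t 1) continuous_const
    hcosG Real.continuous_cos Real.abs_cos_le_one Real.abs_sin_le_one (by simp)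
    (fun _ _ => by simpa)
  have k4 := key (fun _ => 1) (fun _ => 0) _ _ (fun t => hasDerivAt_const t 1) continuous_const
    hsinG Real.continuous_sin Real.abs_sin_le_one hnegcos (by simp)
    (fun _ _ => by simpa)
  simp only [one_mul] at k3 k4
  have hφc : Continuous φ := by simp only [hφ]; fun_prop
  have hsplit : (∫ t₁ in (0:ℝ)..L, ∫ t₂ in (0:ℝ)..L,
        a t₁ * Real.cos (φ t₁ / δ ^ 2 - φ t₂ / δ ^ 2)) =
      (∫ t in (0:ℝ)..L, a t * Real.cos (φ t / δ ^ 2)) *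
        (∫ t in (0:ℝ)..L, Real.cos (φ t / δ ^ 2)) +
      (∫ t in (0:ℝ)..L, a t * Real.sin (φ t / δ ^ 2)) *
        (∫ t in (0:ℝ)..L, Real.sin (φ t / δ ^ 2)) := by
    have hin : ∀ t₁, (∫ t₂ in (0:ℝ)..L, a t₁ * Real.cos (φ t₁ / δ ^ 2 - φ t₂ / δ ^ 2)) =
        a t₁ * Real.cos (φ t₁ / δ ^ 2) * (∫ t in (0:ℝ)..L, Real.cos (φ t / δ ^ 2)) +
        a t₁ * Real.sin (φ t₁ / δ ^ 2) * (∫ t in (0:ℝ)..L, Real.sin (φ t / δ ^ 2)) := by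
      intro t₁
      rw [← intervalIntegral.integral_const_mul, ← intervalIntegral.integral_const_mul,
        ← intervalIntegral.integral_add (Continuous.intervalIntegrable (by fun_prop) _ _)
        (Continuous.intervalIntegrable (by fun_prop) _ _)]
      congr 1
      ext t₂
      rw [Real.cos_sub]
      ring
    simp only [hin]
    rw [intervalIntegral.integral_add (Continuous.intervalIntegrable (by fun_prop) _ _)
        (Continuous.intervalIntegrable (by fun_prop) _ _), intervalIntegral.integral_mul_const,
        intervalIntegral.integral_mul_const]
  simp only [hφδ]
  change |∫ t₁ in (0:ℝ)..L, ∫ t₂ in (0:ℝ)..L,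
    a t₁ * Real.cos (φ t₁ / δ ^ 2 - φ t₂ / δ ^ 2)| ≤ _
  rw [hsplit]
  refine (abs_add_le _ _).trans ?_
  rw [abs_mul, abs_mul]
  have hCδ : 0 ≤ C * δ := by positivity
  have m1 := mul_le_mul k1 k3 (abs_nonneg _) hCδ
  have m2 := mul_le_mul k2 k4 (abs_nonneg _) hCδ
  have hδR : δ ^ 2 ≤ 1 / R := by
    rw [hδ2, inv_eq_one_div]
    exact one_div_le_one_div_of_le hR0 (by nlinarith [Real.pi_gt_three])
  calc _ ≤ 2 * C ^ 2 * δ ^ 2 := by linarith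
    _ ≤ 2 * C ^ 2 * (1 / R) := mul_le_mul_of_nonneg_left hδR (by positivity)
    _ = _ := by ring

lemma mem_latticeSet {m : ℕ} {μ : ℤ × ℤ} :
    μ ∈ latticeSet m ↔ μ.1 ^ 2 + μ.2 ^ 2 = (m : ℤ) := by
  simp only [latticeSet, Finset.mem_filter, Finset.mem_product, Finset.mem_Icc, and_iff_right_iff_imp]
  intro h
  have h1 := Int.le_self_sq μ.1
  have h2 := Int.le_self_sq μ.2
  have h3 := Int.le_self_sq (-μ.1)
  have h4 := Int.le_self_sq (-μ.2)
  refine ⟨⟨?_, ?_⟩, ?_, ?_⟩ <;> nlinarith [sq_nonneg μ.1, sq_nonneg μ.2]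

lemma sum_inv_sqrt_divisors_mul {a b : ℕ} (h : a.Coprime b) :
    ∑ d ∈ (a * b).divisors, (√(d : ℝ))⁻¹ =
      (∑ d ∈ a.divisors, (√(d : ℝ))⁻¹) * ∑ d ∈ b.divisors, (√(d : ℝ))⁻¹ := by
  rw [Nat.divisors_mul, ← Finset.image_mul_product, Finset.sum_image h.mul_injOn_divisors,
    Finset.sum_product, Finset.sum_mul_sum]
  refine Finset.sum_congr rfl fun x _ => Finset.sum_congr rfl fun y _ => ?_
  push_cast
  rw [Real.sqrt_mul (Nat.cast_nonneg x), mul_inv]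

lemma sum_inv_sqrt_divisors_prime_pow_le {p k : ℕ} (hp : p.Prime) :
    ∑ d ∈ (p ^ k).divisors, (√(d : ℝ))⁻¹ ≤ 1 / (1 - (√(p : ℝ))⁻¹) := by
  have h1 : (√(p : ℝ))⁻¹ < 1 := by
    apply inv_lt_one_of_one_lt₀
    rw [Real.lt_sqrt zero_le_one]
    exact_mod_cast (by simpa using hp.one_lt)
  have h := geom_sum_Ico_le_of_lt_one (m := 0) (n := k + 1)
    (inv_nonneg.2 (Real.sqrt_nonneg (p : ℝ))) h1
  rw [Nat.sum_divisors_prime_pow hp]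
  simp only [pow_zero, Nat.Ico_zero_eq_range] at h
  refine le_trans (le_of_eq (Finset.sum_congr rfl fun j _ => ?_)) h
  push_cast
  rw [inv_pow, inv_inj, Real.sqrt_eq_iff_mul_self_eq (by positivity) (by positivity), ← mul_pow,
    Real.mul_self_sqrt (by positivity)]

lemma exists_sum_inv_sqrt_divisors_le {ε : ℝ} (hε : 0 < ε) :
    ∃ C > 0, ∀ n : ℕ, n ≠ 0 →
      ∑ d ∈ n.divisors, (√(d : ℝ))⁻¹ ≤ C * (n.divisors.card : ℝ) ^ ε := by
  have h2 : 1 < (2 : ℝ) ^ ε := Real.one_lt_rpow one_lt_two hε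
  set δ : ℝ := 1 - ((2 : ℝ) ^ ε)⁻¹ with hδ
  have hδ0 : 0 < δ := sub_pos.2 (inv_lt_one_of_one_lt₀ h2)
  obtain ⟨P, hP⟩ := exists_nat_ge ((δ⁻¹) ^ 2)
  have hlarge : ∀ p k : ℕ, p.Prime → P ≤ p →
      ∑ d ∈ (p ^ k).divisors, (√(d : ℝ))⁻¹ ≤ (2 : ℝ) ^ ε := by
    intro p k hp hpP
    refine (sum_inv_sqrt_divisors_prime_pow_le hp).trans ?_
    have h3 : δ⁻¹ ≤ √(p : ℝ) :=
      Real.le_sqrt_of_sq_le (hP.trans (by exact_mod_cast hpP))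
    have h4 : (√(p : ℝ))⁻¹ ≤ δ := inv_le_of_inv_le₀ hδ0 h3
    rw [one_div]
    apply inv_le_of_inv_le₀ (by positivity)
    linarith
  have hsmall : ∀ p k : ℕ, p.Prime → ∑ d ∈ (p ^ k).divisors, (√(d : ℝ))⁻¹ ≤ 4 := by
    intro p k hp
    refine (sum_inv_sqrt_divisors_prime_pow_le hp).trans ?_
    have h3 : (4 / 3 : ℝ) ≤ √(p : ℝ) := by
      apply Real.le_sqrt_of_sq_le
      have : (2 : ℝ) ≤ p := by exact_mod_cast hp.two_le
      linarith
    have h4 : (√(p : ℝ))⁻¹ ≤ 3 / 4 := by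
      have := inv_anti₀ (by norm_num) h3
      norm_num at this ⊢
      exact this
    rw [one_div]
    apply inv_le_of_inv_le₀ (by positivity)
    linarith
  have key : ∀ n : ℕ, n ≠ 0 → ∑ d ∈ n.divisors, (√(d : ℝ))⁻¹ ≤
      4 ^ (n.primeFactors.filter (· < P)).card * (n.divisors.card : ℝ) ^ ε := by
    intro n
    induction n using Nat.recOnPosPrimePosCoprime with
    | zero => simp
    | one => simp
    | prime_pow p k hp hk =>
      intro _
      have h2k : (2 : ℝ) ^ ε ≤ ((p ^ k).divisors.card : ℝ) ^ ε := by
        refine Real.rpow_le_rpow (by norm_num) ?_ hε.le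
        rw [Nat.divisors_prime_pow hp]
        simp only [Finset.card_map, Finset.card_range]
        exact_mod_cast (by omega)
      rw [Nat.primeFactors_prime_pow hk.ne' hp]
      by_cases hpP : p < P
      · simp only [Finset.filter_singleton, hpP, if_true, Finset.card_singleton, pow_one]
        nlinarith [hsmall p k hp]
      · simp only [Finset.filter_singleton, hpP, if_false, Finset.card_empty, pow_zero, one_mul]
        exact (hlarge p k hp (not_lt.1 hpP)).trans h2k
    | coprime a b ha hb hab iha ihb =>
      intro _
      have ha' := iha (by omega)
      have hb' := ihb (by omega)
      rw [sum_inv_sqrt_divisors_mul hab, hab.card_divisors_mul, hab.primeFactors_mul,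
        Finset.filter_union, Finset.card_union_of_disjoint
          (Finset.disjoint_filter_filter hab.disjoint_primeFactors), pow_add]
      push_cast
      rw [Real.mul_rpow (by positivity) (by positivity)]
      calc _ ≤ _ := mul_le_mul ha' hb' (by positivity) (by positivity)
        _ = _ := by ring
  refine ⟨4 ^ P, by positivity, fun n hn => (key n hn).trans ?_⟩
  gcongr
  · norm_num
  · calc _ ≤ (Finset.range P).card := Finset.card_le_card fun x hx => by
          simpa using (Finset.mem_filter.1 hx).2
      _ = P := Finset.card_range P

lemma not_four_dvd_of_isCoprime {x y : ℤ} (h : IsCoprime x y) : ¬ (4 : ℤ) ∣ x ^ 2 + y ^ 2 := by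
  intro h4
  have hx : ¬ ((2 : ℤ) ∣ x ∧ (2 : ℤ) ∣ y) := fun h2 =>
    absurd (h.isUnit_of_dvd' h2.1 h2.2) (by decide)
  rcases Int.even_or_odd' x with ⟨a, rfl | rfl⟩ <;> rcases Int.even_or_odd' y with ⟨b, rfl | rfl⟩
  · exact hx ⟨⟨a, rfl⟩, ⟨b, rfl⟩⟩
  · ring_nf at h4; omega
  · ring_nf at h4; omega
  · ring_nf at h4; omega

lemma isCoprime_left_sq_add_sq {x y : ℤ} (h : IsCoprime x y) : IsCoprime x (x ^ 2 + y ^ 2) := by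
  have h1 : IsCoprime x (y ^ 2) := h.pow_right
  have := h1.add_mul_left_right x
  rwa [show y ^ 2 + x * x = x ^ 2 + y ^ 2 by ring] at this

lemma isCoprime_right_sq_add_sq {x y : ℤ} (h : IsCoprime x y) : IsCoprime y (x ^ 2 + y ^ 2) := by
  rw [add_comm]
  exact isCoprime_left_sq_add_sq h.symm

/-- If two representations of `n` have the same gcd against a fixed primitive one, then `n` divides
their cross product. -/
lemma dvd_cross_of_gcd_eq {n x₀ y₀ x y x' y' : ℤ} (hn : 0 < n)
    (h₀ : IsCoprime x₀ y₀) (hn₀ : x₀ ^ 2 + y₀ ^ 2 = n)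
    (h : IsCoprime x y) (hn₁ : x ^ 2 + y ^ 2 = n) (hn' : x' ^ 2 + y' ^ 2 = n)
    (hg : Int.gcd (x * y₀ - x₀ * y) n = Int.gcd (x' * y₀ - x₀ * y') n) :
    n ∣ x * y' - x' * y := by
  have hxn : IsCoprime x n := hn₁ ▸ isCoprime_left_sq_add_sq h
  have hy₀n : IsCoprime y₀ n := hn₀ ▸ isCoprime_right_sq_add_sq h₀
  obtain ⟨g, hgdef⟩ : ∃ g : ℤ, g = Int.gcd (x * y₀ - x₀ * y) n := ⟨_, rfl⟩
  have hgu : g ∣ x * y₀ - x₀ * y := hgdef ▸ Int.gcd_dvd_left _ _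
  have hgn : g ∣ n := hgdef ▸ Int.gcd_dvd_right _ _
  have hgu' : g ∣ x' * y₀ - x₀ * y' := by rw [hgdef, hg]; exact Int.gcd_dvd_left _ _
  obtain ⟨k, hk⟩ := hgn
  have hcof : ∀ a b : ℤ, a ^ 2 + b ^ 2 = n → g = Int.gcd (a * y₀ - x₀ * b) n →
      k ∣ a * y₀ + x₀ * b := by
    intro a b hab hgab
    have hgpos : g ≠ 0 := by rintro rfl; simp at hk; omega
    have h1 : n ∣ (a * y₀ - x₀ * b) * (a * y₀ + x₀ * b) :=
      ⟨a ^ 2 - x₀ ^ 2, by rw [← hn₀] at hab ⊢; linear_combination (-x₀ ^ 2) * hab⟩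
    have h2 : n ∣ g * (a * y₀ + x₀ * b) := by
      rw [hgab, Int.gcd_eq_gcd_ab, add_mul]
      refine dvd_add ?_ ⟨_, mul_assoc _ _ _⟩
      rw [mul_right_comm]
      exact h1.mul_right _
    rw [hk] at h2
    exact Int.dvd_of_mul_dvd_mul_left hgpos h2
  have hkv := hcof x y hn₁ hgdef
  have hkv' := hcof x' y' hn' (hgdef.trans (by rw [hg]))
  have hgw : g ∣ x * y' - x' * y := by
    refine (hy₀n.of_isCoprime_of_dvd_right ⟨k, hk⟩).symm.dvd_of_dvd_mul_left (y := y₀) ?_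
    have := (hgu.mul_left y').sub (hgu'.mul_left y)
    convert this using 1; ring
  have hkw : k ∣ x * y' - x' * y := by
    refine (hy₀n.of_isCoprime_of_dvd_right ⟨g, by rw [hk, mul_comm]⟩).symm.dvd_of_dvd_mul_left
      (y := y₀) ?_
    have := (hkv.mul_left y').sub (hkv'.mul_left y)
    convert this using 1; ring
  have hgk : IsCoprime g k := by
    rw [Int.isCoprime_iff_gcd_eq_one]
    obtain ⟨d, hd⟩ : ∃ d : ℕ, d = Int.gcd g k := ⟨_, rfl⟩
    rw [← hd]
    have hdg : (d : ℤ) ∣ g := hd ▸ Int.gcd_dvd_left _ _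
    have hdk : (d : ℤ) ∣ k := hd ▸ Int.gcd_dvd_right _ _
    have hdn : (d : ℤ) ∣ n := hdg.trans ⟨k, hk⟩
    have h1 : (d : ℤ) ∣ y₀ * (x * 2) := by
      have := (hdg.trans hgu).add (hdk.trans hkv)
      rwa [show x * y₀ - x₀ * y + (x * y₀ + x₀ * y) = y₀ * (x * 2) by ring] at this
    have h2 : (d : ℤ) ∣ 2 :=
      (hxn.of_isCoprime_of_dvd_right hdn).symm.dvd_of_dvd_mul_left
        ((hy₀n.of_isCoprime_of_dvd_right hdn).symm.dvd_of_dvd_mul_left h1)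
    have h3 : d ∣ 2 := by exact_mod_cast h2
    rcases (Nat.dvd_prime Nat.prime_two).1 h3 with h | h
    · exact h
    · exfalso
      subst h
      apply not_four_dvd_of_isCoprime h₀
      rw [hn₀, hk]
      exact mul_dvd_mul hdg hdk
  rw [hk]
  exact hgk.mul_dvd hgw hkw

lemma eq_rotation_of_dvd_cross {n x y x' y' : ℤ} (hn : 0 < n)
    (hn₁ : x ^ 2 + y ^ 2 = n) (hn' : x' ^ 2 + y' ^ 2 = n) (h : n ∣ x * y' - x' * y) :
    (x', y') ∈ ({(x, y), (-x, -y), (-y, x), (y, -x)} : Finset (ℤ × ℤ)) := by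
  obtain ⟨k, hk⟩ := h
  have hsq : (x * y' - x' * y) ^ 2 + (x * x' + y * y') ^ 2 = n ^ 2 := by
    rw [sq n]; nth_rewrite 1 [← hn₁]; rw [← hn']; ring
  have hs : n ∣ x * x' + y * y' := by
    rw [← Int.pow_dvd_pow_iff two_ne_zero]
    exact ⟨1 - k ^ 2, by rw [hk] at hsq; linear_combination hsq⟩
  obtain ⟨l, hl⟩ := hs
  have hkl : k ^ 2 + l ^ 2 = 1 := by
    rw [hk, hl] at hsq
    have : n ^ 2 * (k ^ 2 + l ^ 2) = n ^ 2 * 1 := by linear_combination hsq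
    exact mul_left_cancel₀ (by positivity) this
  have hx' : x' = l * x - k * y := by
    apply mul_left_cancel₀ hn.ne'
    linear_combination (-x') * hn₁ + x * hl - y * hk
  have hy' : y' = l * y + k * x := by
    apply mul_left_cancel₀ hn.ne'
    linear_combination (-y') * hn₁ + y * hl + x * hk
  have hk1 : -1 ≤ k ∧ k ≤ 1 := ⟨by nlinarith [sq_nonneg l], by nlinarith [sq_nonneg l]⟩
  have hl1 : -1 ≤ l ∧ l ≤ 1 := ⟨by nlinarith [sq_nonneg k], by nlinarith [sq_nonneg k]⟩
  obtain ⟨hk1, hk2⟩ := hk1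
  obtain ⟨hl1, hl2⟩ := hl1
  simp only [Finset.mem_insert, Finset.mem_singleton, Prod.mk.injEq]
  interval_cases k <;> interval_cases l <;> simp at hkl <;> simp [hx', hy']

lemma card_filter_isCoprime_latticeSet_le {n : ℕ} (hn : 0 < n) :
    ((latticeSet n).filter fun p => Int.gcd p.1 p.2 = 1).card ≤ 4 * n.divisors.card := by
  rcases ((latticeSet n).filter fun p => Int.gcd p.1 p.2 = 1).eq_empty_or_nonempty with h | ⟨p₀, hp₀⟩
  · simp [h]
  rw [Finset.mem_filter, mem_latticeSet, ← Int.isCoprime_iff_gcd_eq_one] at hp₀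
  refine Finset.card_le_mul_card_image_of_maps_to
    (f := fun p : ℤ × ℤ => Int.gcd (p.1 * p₀.2 - p₀.1 * p.2) n) ?_ 4 ?_
  · intro p _
    rw [Nat.mem_divisors]
    exact ⟨by exact_mod_cast Int.gcd_dvd_right (p.1 * p₀.2 - p₀.1 * p.2) n, hn.ne'⟩
  · intro g _
    rcases (((latticeSet n).filter fun p => Int.gcd p.1 p.2 = 1).filter fun p =>
      Int.gcd (p.1 * p₀.2 - p₀.1 * p.2) n = g).eq_empty_or_nonempty with h | ⟨p, hp⟩
    · simp [h]
    · rw [Finset.mem_filter, Finset.mem_filter, mem_latticeSet, ← Int.isCoprime_iff_gcd_eq_one] at hp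
      refine (Finset.card_le_card
        (t := {(p.1, p.2), (-p.1, -p.2), (-p.2, p.1), (p.2, -p.1)}) fun q hq => ?_).trans
        Finset.card_le_four
      rw [Finset.mem_filter, Finset.mem_filter, mem_latticeSet] at hq
      have hn' : (0 : ℤ) < n := by exact_mod_cast hn
      exact eq_rotation_of_dvd_cross hn' hp.1.1 hq.1.1
        (dvd_cross_of_gcd_eq hn' hp₀.2 hp₀.1 hp.1.2 hp.1.1 hq.1.1 (hp.2.trans hq.2.symm))

lemma dvd_norm_of_dvd {a b : GaussianInt} (h : a ∣ b) : a.norm ∣ b.norm := by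
  obtain ⟨c, rfl⟩ := h
  exact ⟨c.norm, Zsqrtd.norm_mul a c⟩

lemma prime_of_norm_eq_prime {p : ℕ} (hp : p.Prime) {z : GaussianInt} (hz : z.norm = p) :
    Prime z := by
  refine Irreducible.prime ⟨fun h => ?_, fun a b hab => ?_⟩
  · rw [← Zsqrtd.norm_eq_one_iff, hz] at h
    exact hp.one_lt.ne' (by simpa using h)
  · have h : a.norm.natAbs * b.norm.natAbs = p := by
      rw [← Int.natAbs_mul, ← Zsqrtd.norm_mul, ← hab, hz, Int.natAbs_natCast]
    rw [← Zsqrtd.norm_eq_one_iff, ← Zsqrtd.norm_eq_one_iff]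
    rcases (Nat.dvd_prime hp).1 ⟨_, h.symm⟩ with h1 | h1
    · exact Or.inl h1
    · right
      rw [h1] at h
      exact Nat.eq_of_mul_eq_mul_left hp.pos (by simpa using h)

lemma not_dvd_star_of_norm_eq_prime {p : ℕ} (hp : p.Prime) (hp2 : p ≠ 2) {z : GaussianInt}
    (hz : z.norm = p) : ¬ z ∣ star z := by
  intro h
  have hz' : z.re ^ 2 + z.im ^ 2 = p := by rw [← hz, Zsqrtd.norm_def]; ring
  have h1 : z ∣ ((2 * z.re : ℤ) : GaussianInt) := by
    have := (dvd_refl z).add h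
    convert this using 1
    ext <;> simp
    ring
  have h2 := dvd_norm_of_dvd h1
  rw [hz, Zsqrtd.norm_intCast] at h2
  have hpi : Prime (p : ℤ) := Nat.prime_iff_prime_int.1 hp
  have h3 : (p : ℤ) ∣ 2 * z.re := (hpi.dvd_or_dvd h2).elim id id
  have h4 : (p : ℤ) ∣ z.re := by
    refine (hpi.dvd_or_dvd h3).resolve_left fun h => hp2 ?_
    exact (Nat.prime_dvd_prime_iff_eq hp Nat.prime_two).1 (by exact_mod_cast h)
  have h5 : (p : ℤ) ∣ z.im := by
    refine hpi.dvd_of_dvd_pow (n := 2) ?_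
    have : z.im ^ 2 = p - z.re ^ 2 := by linarith
    rw [this]
    exact (dvd_refl _).sub (dvd_pow h4 two_ne_zero)
  have h6 : (p : ℤ) * p ∣ p := by
    nth_rewrite 3 [← hz']
    rw [sq, sq]
    exact (mul_dvd_mul h4 h4).add (mul_dvd_mul h5 h5)
  have h7 : p * p ∣ p * 1 := by rw [mul_one]; exact_mod_cast h6
  exact hp.one_lt.ne' (Nat.dvd_one.1 (Nat.dvd_of_mul_dvd_mul_left hp.pos h7))

lemma succ_mul_latN_le {p e k : ℕ} (hp : p.Prime) (hp4 : p % 4 = 1) (hpk : ¬ p ∣ k) :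
    (e + 1) * latN k ≤ latN (p ^ e * k) := by
  have : Fact p.Prime := ⟨hp⟩
  obtain ⟨a, b, hab⟩ := Nat.Prime.sq_add_sq (p := p) (by omega)
  obtain ⟨z, hz⟩ : ∃ z : GaussianInt, z.norm = p :=
    ⟨⟨a, b⟩, by rw [Zsqrtd.norm_def, ← hab]; push_cast; ring⟩
  have hzp := prime_of_norm_eq_prime hp hz
  have hzs := not_dvd_star_of_norm_eq_prime hp (by rintro rfl; omega) hz
  have hz0 : z ≠ 0 := hzp.ne_zero
  have hs0 : star z ≠ 0 := by simpa using hz0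
  have key : ∀ j₁ j₂ : ℕ, ∀ w₁ w₂ : GaussianInt, j₁ < j₂ → j₂ ≤ e → w₁.norm = k →
      z ^ j₁ * star z ^ (e - j₁) * w₁ ≠ z ^ j₂ * star z ^ (e - j₂) * w₂ := by
    intro j₁ j₂ w₁ w₂ hj he hw h
    obtain ⟨d, rfl⟩ := Nat.exists_eq_add_of_lt hj
    have h1 : e - j₁ = (e - (j₁ + d + 1)) + (d + 1) := by omega
    have h2 : star z ^ (d + 1) * w₁ = z * (z ^ d * w₂) := by
      apply mul_left_cancel₀ (pow_ne_zero j₁ hz0)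
      apply mul_left_cancel₀ (pow_ne_zero (e - (j₁ + d + 1)) hs0)
      rw [h1, pow_add] at h
      linear_combination h
    rcases hzp.dvd_or_dvd (Dvd.intro _ h2.symm) with h3 | h3
    · exact hzs (hzp.dvd_of_dvd_pow h3)
    · have := dvd_norm_of_dvd h3
      rw [hz, hw] at this
      exact hpk (by exact_mod_cast this)
  have hnorm : ∀ μ ∈ latticeSet k, (⟨μ.1, μ.2⟩ : GaussianInt).norm = k := by
    intro μ hμ
    rw [mem_latticeSet] at hμ
    rw [Zsqrtd.norm_def, ← hμ]; ring
  have hcard : (e + 1) * latN k = (Finset.range (e + 1) ×ˢ latticeSet k).card := by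
    rw [Finset.card_product, Finset.card_range, latN]
  rw [hcard, latN]
  refine Finset.card_le_card_of_injOn
    (fun q => ((z ^ q.1 * star z ^ (e - q.1) * (⟨q.2.1, q.2.2⟩ : GaussianInt)).re,
      (z ^ q.1 * star z ^ (e - q.1) * (⟨q.2.1, q.2.2⟩ : GaussianInt)).im)) ?_ ?_
  · rintro ⟨j, μ⟩ hq
    simp only [Finset.coe_product, Set.mem_prod, Finset.mem_coe, Finset.mem_range] at hq
    have h1 : (z ^ j * star z ^ (e - j) * (⟨μ.1, μ.2⟩ : GaussianInt)).norm = (p : ℤ) ^ e * k := by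
      have hpow : ∀ (w : GaussianInt) (n : ℕ), (w ^ n).norm = w.norm ^ n := fun w n =>
        map_pow Zsqrtd.normMonoidHom w n
      rw [Zsqrtd.norm_mul, Zsqrtd.norm_mul, hpow, hpow, Zsqrtd.norm_conj, hz, hnorm μ hq.2,
        ← pow_add, Nat.add_sub_cancel' (by omega)]
    simp only [Finset.mem_coe, mem_latticeSet]
    push_cast
    rw [← h1, Zsqrtd.norm_def]
    ring
  · rintro ⟨j₁, μ⟩ h₁ ⟨j₂, ν⟩ h₂ h
    simp only [Finset.coe_product, Set.mem_prod, Finset.mem_coe, Finset.mem_range] at h₁ h₂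
    have h' : z ^ j₁ * star z ^ (e - j₁) * (⟨μ.1, μ.2⟩ : GaussianInt) =
        z ^ j₂ * star z ^ (e - j₂) * (⟨ν.1, ν.2⟩ : GaussianInt) := by
      rw [Prod.mk.injEq] at h
      exact Zsqrtd.ext h.1 h.2
    rcases lt_trichotomy j₁ j₂ with hj | rfl | hj
    · exact absurd h' (key _ _ _ _ hj (by omega) (hnorm μ h₁.2))
    · have h3 := mul_left_cancel₀ (mul_ne_zero (pow_ne_zero _ hz0) (pow_ne_zero _ hs0)) h'
      rw [Zsqrtd.mk.injEq] at h3
      rw [Prod.ext h3.1 h3.2]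
    · exact absurd h'.symm (key _ _ _ _ hj (by omega) (hnorm ν h₂.2))

lemma card_divisors_mul_latN_le {M : ℕ} : ∀ {k : ℕ}, M ≠ 0 →
    (∀ p : ℕ, p.Prime → p ∣ M → p % 4 = 1) → M.Coprime k →
    M.divisors.card * latN k ≤ latN (M * k) := by
  induction M using Nat.recOnPosPrimePosCoprime with
  | zero => intro k h; exact absurd rfl h
  | one => simp
  | prime_pow p e hp he =>
    intro k _ h hc
    rw [Nat.divisors_prime_pow hp, Finset.card_map, Finset.card_range]
    refine succ_mul_latN_le hp (h p hp (dvd_pow_self p he.ne')) ?_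
    exact (Nat.Prime.coprime_iff_not_dvd hp).1 (hc.coprime_dvd_left (dvd_pow_self p he.ne'))
  | coprime a b ha hb hab iha ihb =>
    intro k _ h hc
    have h1 := ihb (k := k) (by omega) (fun p hp hd => h p hp (hd.mul_left a))
      (hc.coprime_dvd_left (Dvd.intro_left a rfl))
    have h2 := iha (k := b * k) (by omega) (fun p hp hd => h p hp (hd.mul_right b))
      (hab.mul_right (hc.coprime_dvd_left (Dvd.intro b rfl)))
    rw [hab.card_divisors_mul, mul_assoc a b k, mul_assoc]
    exact (Nat.mul_le_mul_left _ h1).trans h2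

lemma exists_eq_mul_mod_four {m : ℕ} : m ≠ 0 → ∃ M k : ℕ, m = M * k ∧
    (∀ p : ℕ, p.Prime → p ∣ M → p % 4 = 1) ∧ (∀ p : ℕ, p.Prime → p ∣ k → p % 4 ≠ 1) := by
  induction m using Nat.recOnPosPrimePosCoprime with
  | zero => intro h; exact absurd rfl h
  | one =>
    intro _
    exact ⟨1, 1, rfl, fun p hp h => absurd (Nat.dvd_one.1 h) hp.one_lt.ne',
      fun p hp h => absurd (Nat.dvd_one.1 h) hp.one_lt.ne'⟩
  | prime_pow q e hq he =>
    intro _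
    by_cases h4 : q % 4 = 1
    · refine ⟨q ^ e, 1, (mul_one _).symm, fun p hp h => ?_,
        fun p hp h => absurd (Nat.dvd_one.1 h) hp.one_lt.ne'⟩
      rwa [(Nat.prime_dvd_prime_iff_eq hp hq).1 (hp.dvd_of_dvd_pow h)]
    · refine ⟨1, q ^ e, (one_mul _).symm,
        fun p hp h => absurd (Nat.dvd_one.1 h) hp.one_lt.ne', fun p hp h => ?_⟩
      rwa [(Nat.prime_dvd_prime_iff_eq hp hq).1 (hp.dvd_of_dvd_pow h)]
  | coprime a b ha hb hab iha ihb =>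
    intro _
    obtain ⟨M₁, k₁, rfl, h₁, h₁'⟩ := iha (by omega)
    obtain ⟨M₂, k₂, rfl, h₂, h₂'⟩ := ihb (by omega)
    refine ⟨M₁ * M₂, k₁ * k₂, by ring, fun p hp h => ?_, fun p hp h => ?_⟩
    · exact (hp.dvd_mul.1 h).elim (h₁ p hp) (h₂ p hp)
    · exact (hp.dvd_mul.1 h).elim (h₁' p hp) (h₂' p hp)

lemma latN_pos_iff {m : ℕ} : 0 < latN m ↔ ∃ x y : ℕ, m = x ^ 2 + y ^ 2 := by
  rw [latN, Finset.card_pos]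
  constructor
  · rintro ⟨μ, hμ⟩
    rw [mem_latticeSet] at hμ
    refine ⟨μ.1.natAbs, μ.2.natAbs, ?_⟩
    zify
    rw [sq_abs, sq_abs, hμ]
  · rintro ⟨x, y, rfl⟩
    exact ⟨(x, y), mem_latticeSet.2 (by push_cast; rfl)⟩

lemma latN_pos_of_mul {M k : ℕ} (hM : ∀ p : ℕ, p.Prime → p ∣ M → p % 4 = 1) (h0 : M * k ≠ 0)
    (h : 0 < latN (M * k)) : 0 < latN k := by
  rw [latN_pos_iff, Nat.eq_sq_add_sq_iff] at h ⊢
  intro q hq hq3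
  have : Fact q.Prime := ⟨Nat.prime_of_mem_primeFactors hq⟩
  have hqM : ¬ q ∣ M := fun hd => by
    have := hM q (Nat.prime_of_mem_primeFactors hq) hd
    omega
  have h1 := h q (Nat.primeFactors_mono (Dvd.intro_left M rfl) h0 hq) hq3
  rwa [padicValNat.mul (left_ne_zero_of_mul h0) (right_ne_zero_of_mul h0),
    padicValNat.eq_zero_of_not_dvd hqM, zero_add] at h1

/-- A primitive norm dividing `4 * m` divides twice the part of `m` supported on primes
congruent to `1` modulo `4`. -/
lemma dvd_two_mul_of_isCoprime {M k n : ℕ} (hk : ∀ p : ℕ, p.Prime → p ∣ k → p % 4 ≠ 1)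
    {x y : ℤ} (hxy : IsCoprime x y) (hn : x ^ 2 + y ^ 2 = n) (hd : n ∣ 4 * (M * k)) :
    n ∣ 2 * M := by
  have h3 : ∀ p : ℕ, p.Prime → p ∣ n → p % 4 ≠ 3 := by
    intro p hp hpn
    have hs := ZMod.isSquare_neg_one_of_eq_sq_add_sq_of_isCoprime hn.symm hxy
    rw [Int.natAbs_natCast] at hs
    have hp' : p ∈ p.primeFactors := by simp [hp.primeFactors]
    exact Nat.mod_four_ne_three_of_mem_primeFactors_of_isSquare_neg_one hp'
      (ZMod.isSquare_neg_one_of_dvd hpn hs)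
  have hodd : ∀ n' : ℕ, n' ∣ n → ¬ 2 ∣ n' → n' ∣ M := by
    intro n' hn' h2
    have hc : n'.Coprime (4 * k) := by
      refine Nat.Coprime.mul_right ?_ ?_
      · exact (((Nat.Prime.coprime_iff_not_dvd Nat.prime_two).2 h2).symm.pow_right 2)
      · refine Nat.coprime_of_dvd fun p hp hpn hpk => ?_
        have h5 := h3 p hp (hpn.trans hn')
        have h6 := hk p hp hpk
        rcases hp.eq_two_or_odd with rfl | h7
        · exact h2 hpn
        · omega
    refine hc.dvd_of_dvd_mul_left ?_
    rw [show 4 * k * M = 4 * (M * k) by ring]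
    exact hn'.trans hd
  by_cases h2 : 2 ∣ n
  · obtain ⟨n', rfl⟩ := h2
    refine mul_dvd_mul_left 2 (hodd n' (Dvd.intro_left 2 rfl) fun h => ?_)
    apply not_four_dvd_of_isCoprime hxy
    rw [hn]
    obtain ⟨c, rfl⟩ := h
    exact ⟨c, by push_cast; ring⟩
  · exact (hodd n dvd_rfl h2).mul_left 2

lemma sum_card_divisors_div_sqrt_le (Q : ℕ) (hQ : Q ≠ 0) :
    ∑ n ∈ Q.divisors, (n.divisors.card : ℝ) * (√(n : ℝ))⁻¹ ≤
      (∑ d ∈ Q.divisors, (√(d : ℝ))⁻¹) ^ 2 := by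
  have hnn : ∀ p : ℕ × ℕ, 0 ≤ (√(p.1 : ℝ))⁻¹ * (√(p.2 : ℝ))⁻¹ := fun p => by positivity
  set T := (Q.divisors ×ˢ Q.divisors).filter fun p : ℕ × ℕ => p.1 * p.2 ∈ Q.divisors with hT
  calc ∑ n ∈ Q.divisors, (n.divisors.card : ℝ) * (√(n : ℝ))⁻¹
      ≤ ∑ n ∈ Q.divisors, ∑ p ∈ T.filter fun p => p.1 * p.2 = n,
          (√(p.1 : ℝ))⁻¹ * (√(p.2 : ℝ))⁻¹ := by
        refine Finset.sum_le_sum fun n hn => ?_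
        have hc : n.divisors.card = n.divisorsAntidiagonal.card := by
          rw [← Nat.map_div_right_divisors, Finset.card_map]
        have hs : (n.divisors.card : ℝ) * (√(n : ℝ))⁻¹ =
            ∑ p ∈ n.divisorsAntidiagonal, (√(p.1 : ℝ))⁻¹ * (√(p.2 : ℝ))⁻¹ := by
          rw [hc, ← nsmul_eq_mul, ← Finset.sum_const]
          refine Finset.sum_congr rfl fun p hp => ?_
          rw [← (Nat.mem_divisorsAntidiagonal.1 hp).1, Nat.cast_mul,
            Real.sqrt_mul (Nat.cast_nonneg _), mul_inv]
        rw [hs]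
        refine Finset.sum_le_sum_of_subset_of_nonneg (fun p hp => ?_) fun p _ _ => hnn p
        have hp' := (Nat.mem_divisorsAntidiagonal.1 hp).1
        have hnQ := Nat.dvd_of_mem_divisors hn
        rw [Finset.mem_filter, hT, Finset.mem_filter, Finset.mem_product, Nat.mem_divisors,
          Nat.mem_divisors]
        exact ⟨⟨⟨⟨(Dvd.intro _ hp').trans hnQ, hQ⟩, (Dvd.intro_left _ hp').trans hnQ, hQ⟩,
          hp'.symm ▸ hn⟩, hp'⟩
    _ = ∑ p ∈ T, (√(p.1 : ℝ))⁻¹ * (√(p.2 : ℝ))⁻¹ :=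
        Finset.sum_fiberwise_of_maps_to (fun p hp => (Finset.mem_filter.1 hp).2) _
    _ ≤ ∑ p ∈ Q.divisors ×ˢ Q.divisors, (√(p.1 : ℝ))⁻¹ * (√(p.2 : ℝ))⁻¹ :=
        Finset.sum_le_sum_of_subset_of_nonneg (Finset.filter_subset _ _) fun p _ _ => hnn p
    _ = (∑ d ∈ Q.divisors, (√(d : ℝ))⁻¹) ^ 2 := by
        rw [sq, Finset.sum_mul_sum, Finset.sum_product]

lemma exists_card_divisors_le_latN {m : ℕ} (hm : m ≠ 0) (h : 0 < latN m) :
    ∃ Q : ℕ, Q ≠ 0 ∧ Q.divisors.card ≤ 2 * latN m ∧ ∀ n : ℕ, ∀ x y : ℤ, IsCoprime x y →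
      x ^ 2 + y ^ 2 = n → n ∣ 4 * m → n ∣ Q := by
  obtain ⟨M, k, rfl, hM, hk⟩ := exists_eq_mul_mod_four hm
  have hM0 := left_ne_zero_of_mul hm
  have hMk : M.Coprime k := Nat.coprime_of_dvd fun p hp h1 h2 => hk p hp h2 (hM p hp h1)
  have h2M : Nat.Coprime 2 M := (Nat.Prime.coprime_iff_not_dvd Nat.prime_two).2 fun h2 => by
    have := hM 2 Nat.prime_two h2
    omega
  refine ⟨2 * M, by simpa using hM0, ?_, fun n x y hxy hn hd => dvd_two_mul_of_isCoprime hk hxy hn hd⟩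
  rw [h2M.card_divisors_mul, Nat.Prime.divisors Nat.prime_two, Finset.card_pair (by norm_num)]
  exact Nat.mul_le_mul_left 2 ((Nat.le_mul_of_pos_right _ (latN_pos_of_mul hM hm h)).trans
    (card_divisors_mul_latN_le hM0 hM hMk))

lemma exists_sum_primitive_le {ε : ℝ} (hε : 0 < ε) :
    ∃ C > 0, ∀ m : ℕ, m ≠ 0 → 0 < latN m → ∀ S : Finset (ℤ × ℤ),
      (∀ p ∈ S, IsCoprime p.1 p.2 ∧ p.1 ^ 2 + p.2 ^ 2 ∣ 4 * (m : ℤ)) →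
      ∑ p ∈ S, (√((p.1 : ℝ) ^ 2 + (p.2 : ℝ) ^ 2))⁻¹ ≤ C * (latN m : ℝ) ^ ε := by
  obtain ⟨C, hC, h⟩ := exists_sum_inv_sqrt_divisors_le (half_pos hε)
  refine ⟨4 * (C ^ 2 * 2 ^ ε), by positivity, fun m hm hN S hS => ?_⟩
  obtain ⟨Q, hQ, hcard, hQd⟩ := exists_card_divisors_le_latN hm hN
  have hmaps : ∀ p ∈ S, (p.1 ^ 2 + p.2 ^ 2).natAbs ∈ Q.divisors := by
    intro p hp
    obtain ⟨h1, h2⟩ := hS p hp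
    rw [Nat.mem_divisors]
    refine ⟨hQd _ p.1 p.2 h1 (Int.natAbs_of_nonneg (by positivity)).symm ?_, hQ⟩
    have := Int.natAbs_dvd_natAbs.2 h2
    rwa [Int.natAbs_mul, Int.natAbs_natCast] at this
  calc ∑ p ∈ S, (√((p.1 : ℝ) ^ 2 + (p.2 : ℝ) ^ 2))⁻¹
      = ∑ n ∈ Q.divisors, ∑ p ∈ S.filter fun p => (p.1 ^ 2 + p.2 ^ 2).natAbs = n,
          (√((p.1 : ℝ) ^ 2 + (p.2 : ℝ) ^ 2))⁻¹ := by
          rw [Finset.sum_fiberwise_of_maps_to hmaps]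
    _ ≤ ∑ n ∈ Q.divisors, 4 * ((n.divisors.card : ℝ) * (√(n : ℝ))⁻¹) := by
        refine Finset.sum_le_sum fun n hn => ?_
        have hnp : 0 < n := Nat.pos_of_mem_divisors hn
        have hmem : ∀ p ∈ S.filter fun p => (p.1 ^ 2 + p.2 ^ 2).natAbs = n,
            p.1 ^ 2 + p.2 ^ 2 = (n : ℤ) := by
          intro p hp
          rw [← (Finset.mem_filter.1 hp).2, Int.natAbs_of_nonneg (by positivity)]
        have h1 : ((S.filter fun p => (p.1 ^ 2 + p.2 ^ 2).natAbs = n).card : ℝ) ≤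
            4 * n.divisors.card := by
          have h2 : (S.filter fun p => (p.1 ^ 2 + p.2 ^ 2).natAbs = n).card ≤
              4 * n.divisors.card :=
            (Finset.card_le_card fun p hp => Finset.mem_filter.2
              ⟨mem_latticeSet.2 (hmem p hp), Int.isCoprime_iff_gcd_eq_one.1
                (hS p (Finset.mem_filter.1 hp).1).1⟩).trans
                (card_filter_isCoprime_latticeSet_le hnp)
          exact_mod_cast h2
        rw [Finset.sum_congr rfl (g := fun _ => (√(n : ℝ))⁻¹) fun p hp => by
          rw [← Int.cast_natCast n, ← hmem p hp]; push_cast; rfl]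
        rw [Finset.sum_const, nsmul_eq_mul, ← mul_assoc]
        gcongr
    _ ≤ 4 * (∑ d ∈ Q.divisors, (√(d : ℝ))⁻¹) ^ 2 := by
        rw [← Finset.mul_sum]
        gcongr
        exact sum_card_divisors_div_sqrt_le Q hQ
    _ ≤ 4 * (C * (Q.divisors.card : ℝ) ^ (ε / 2)) ^ 2 := by
        gcongr
        exact h Q hQ
    _ = 4 * (C ^ 2 * (Q.divisors.card : ℝ) ^ ε) := by
        rw [mul_pow, ← Real.rpow_mul_natCast (by positivity)]
        norm_num
    _ ≤ 4 * (C ^ 2 * (2 * latN m : ℝ) ^ ε) := by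
        gcongr
        exact_mod_cast hcard
    _ = 4 * (C ^ 2 * 2 ^ ε) * (latN m : ℝ) ^ ε := by
        rw [Real.mul_rpow (by norm_num) (by positivity)]
        ring

lemma sum_inv_le_harmonic {ι : Type*} (T : Finset ι) (g : ι → ℕ) (N : ℕ)
    (hpos : ∀ i ∈ T, 0 < g i) (hN : T.card ≤ N) (h2 : ∀ j, (T.filter (g · = j)).card ≤ 2) :
    ∑ i ∈ T, ((g i : ℝ))⁻¹ ≤ 2 * (harmonic N : ℝ) + 1 := by
  rw [← Finset.sum_filter_add_sum_filter_not T (fun i => g i ≤ N)]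
  refine add_le_add ?_ ?_
  · rw [← Finset.sum_fiberwise_of_maps_to (t := Finset.Icc 1 N) (g := g) fun i hi => by
      rw [Finset.mem_filter] at hi
      exact Finset.mem_Icc.2 ⟨hpos i hi.1, hi.2⟩]
    rw [harmonic_eq_sum_Icc]
    push_cast
    rw [Finset.mul_sum]
    refine Finset.sum_le_sum fun j _ => ?_
    rw [Finset.sum_congr rfl (g := fun _ => ((j : ℝ))⁻¹) fun i hi => by
      rw [(Finset.mem_filter.1 hi).2]]
    rw [Finset.sum_const, nsmul_eq_mul]
    gcongr
    have : ((T.filter fun i => g i ≤ N).filter fun i => g i = j).card ≤ 2 :=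
      (Finset.card_le_card (Finset.filter_subset_filter _ (Finset.filter_subset _ _))).trans (h2 j)
    exact_mod_cast this
  · have h1 : ∀ i ∈ T.filter (fun i => ¬ g i ≤ N), ((g i : ℝ))⁻¹ ≤ ((N : ℝ) + 1)⁻¹ := by
      intro i hi
      have hi' := (Finset.mem_filter.1 hi).2
      apply inv_anti₀ (by positivity)
      exact_mod_cast (by omega)
    refine (Finset.sum_le_card_nsmul _ _ _ h1).trans ?_
    rw [nsmul_eq_mul, ← div_eq_mul_inv, div_le_one (by positivity)]
    have := (Finset.card_filter_le T (fun i => ¬ g i ≤ N)).trans hN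
    exact_mod_cast this.trans (Nat.le_succ N)

lemma harmonic_le_rpow {ε : ℝ} (hε : 0 < ε) {N : ℕ} (hN : 0 < N) :
    2 * (harmonic N : ℝ) + 1 ≤ (3 + 2 / ε) * (N : ℝ) ^ ε := by
  have h1 := harmonic_le_one_add_log N
  have h2 := Real.log_le_rpow_div (Nat.cast_nonneg N) hε
  have h3 : 1 ≤ (N : ℝ) ^ ε := Real.one_le_rpow (by exact_mod_cast hN) hε.le
  have h4 : (3 + 2 / ε) * (N : ℝ) ^ ε = 3 * (N : ℝ) ^ ε + 2 * ((N : ℝ) ^ ε / ε) := by ring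
  linarith

lemma exists_rotation_of_orthogonal {a b x y : ℤ} (h : IsCoprime a b) (h0 : a * x + b * y = 0) :
    ∃ c, x = -c * b ∧ y = c * a := by
  obtain ⟨u, v, huv⟩ := h
  exact ⟨u * y - v * x, by linear_combination (-x) * huv + u * h0,
    by linear_combination (-y) * huv + v * h0⟩

/-- The content of the difference of a pair of lattice points. -/
def diffGcd (q : (ℤ × ℤ) × (ℤ × ℤ)) : ℕ := Int.gcd (q.1.1 - q.2.1) (q.1.2 - q.2.2)

/-- The primitive part of the difference of a pair of lattice points. -/
def diffPrim (q : (ℤ × ℤ) × (ℤ × ℤ)) : ℤ × ℤ :=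
  ((q.1.1 - q.2.1) / diffGcd q, (q.1.2 - q.2.2) / diffGcd q)

lemma diffGcd_mul_fst (q : (ℤ × ℤ) × (ℤ × ℤ)) :
    q.1.1 - q.2.1 = diffGcd q * (diffPrim q).1 :=
  (Int.mul_ediv_cancel' (Int.gcd_dvd_left _ _)).symm

lemma diffGcd_mul_snd (q : (ℤ × ℤ) × (ℤ × ℤ)) :
    q.1.2 - q.2.2 = diffGcd q * (diffPrim q).2 :=
  (Int.mul_ediv_cancel' (Int.gcd_dvd_right _ _)).symm

lemma diffGcd_pos {q : (ℤ × ℤ) × (ℤ × ℤ)} (h : q.1 ≠ q.2) : 0 < diffGcd q := by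
  rw [Nat.pos_iff_ne_zero]
  intro h0
  rw [diffGcd, Int.gcd_eq_zero_iff] at h0
  exact h (Prod.ext (sub_eq_zero.1 h0.1) (sub_eq_zero.1 h0.2))

lemma isCoprime_diffPrim {q : (ℤ × ℤ) × (ℤ × ℤ)} (h : q.1 ≠ q.2) :
    IsCoprime (diffPrim q).1 (diffPrim q).2 := by
  rw [Int.isCoprime_iff_gcd_eq_one]
  exact Int.gcd_ediv_gcd_ediv_gcd (diffGcd_pos h)

lemma exists_sum_eq_rotation_diffPrim {m : ℕ} {q : (ℤ × ℤ) × (ℤ × ℤ)}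
    (hq : q ∈ (latticeSet m).offDiag) :
    ∃ b : ℤ, q.1.1 + q.2.1 = -b * (diffPrim q).2 ∧ q.1.2 + q.2.2 = b * (diffPrim q).1 ∧
      ((diffPrim q).1 ^ 2 + (diffPrim q).2 ^ 2) * ((diffGcd q : ℤ) ^ 2 + b ^ 2) = 4 * m := by
  rw [Finset.mem_offDiag, mem_latticeSet, mem_latticeSet] at hq
  obtain ⟨h1, h2, hne⟩ := hq
  have hg : (diffGcd q : ℤ) ≠ 0 := by exact_mod_cast (diffGcd_pos hne).ne'
  have e1 := diffGcd_mul_fst q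
  have e2 := diffGcd_mul_snd q
  obtain ⟨b, hb1, hb2⟩ := exists_rotation_of_orthogonal (x := q.1.1 + q.2.1) (y := q.1.2 + q.2.2)
    (isCoprime_diffPrim hne) (by
      apply mul_left_cancel₀ hg
      rw [mul_add, ← mul_assoc, ← mul_assoc, ← e1, ← e2]
      linear_combination h1 - h2)
  refine ⟨b, hb1, hb2, ?_⟩
  calc _ = (diffGcd q * (diffPrim q).1) ^ 2 + (diffGcd q * (diffPrim q).2) ^ 2 +
        (-b * (diffPrim q).2) ^ 2 + (b * (diffPrim q).1) ^ 2 := by ring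
    _ = 4 * m := by
      rw [← e1, ← e2, ← hb1, ← hb2]
      linear_combination 2 * h1 + 2 * h2

lemma card_filter_diffPrim_le (m : ℕ) (p : ℤ × ℤ) :
    ((latticeSet m).offDiag.filter fun q => diffPrim q = p).card ≤ latN m := by
  refine Finset.card_le_card_of_injOn (fun q => q.1) (fun q hq => ?_) ?_
  · rw [Finset.mem_coe, Finset.mem_filter, Finset.mem_offDiag] at hq
    exact hq.1.1
  · intro q hq q' hq' h
    rw [Finset.mem_coe, Finset.mem_filter, Finset.mem_offDiag, mem_latticeSet,
      mem_latticeSet] at hq hq'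
    obtain ⟨⟨h1, h2, hne⟩, rfl⟩ := hq
    obtain ⟨⟨h1', h2', hne'⟩, hp⟩ := hq'
    have e1 := diffGcd_mul_fst q
    have e2 := diffGcd_mul_snd q
    have e1' := diffGcd_mul_fst q'
    have e2' := diffGcd_mul_snd q'
    have hg : (diffGcd q : ℤ) ≠ 0 := by exact_mod_cast (diffGcd_pos hne).ne'
    have hg' : (diffGcd q' : ℤ) ≠ 0 := by exact_mod_cast (diffGcd_pos hne').ne'
    rw [hp] at e1' e2'
    change q.1 = q'.1 at h
    rw [← h] at e1' e2'
    have hpn := (isCoprime_diffPrim hne).sq_add_sq_ne_zero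
    have key : ∀ g : ℤ, g ≠ 0 → ∀ x y : ℤ, x ^ 2 + y ^ 2 = m → q.1.1 - x = g * (diffPrim q).1 →
        q.1.2 - y = g * (diffPrim q).2 → g * ((diffPrim q).1 ^ 2 + (diffPrim q).2 ^ 2) =
          2 * (q.1.1 * (diffPrim q).1 + q.1.2 * (diffPrim q).2) := by
      intro g hg x y hxy hx hy
      apply mul_left_cancel₀ hg
      rw [show x = q.1.1 - g * (diffPrim q).1 by linarith,
        show y = q.1.2 - g * (diffPrim q).2 by linarith] at hxy
      linear_combination hxy - h1
    have hgg : (diffGcd q : ℤ) = diffGcd q' :=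
      mul_right_cancel₀ hpn ((key _ hg _ _ h2 e1 e2).trans (key _ hg' _ _ h2' e1' e2').symm)
    rw [← hgg] at e1' e2'
    exact Prod.ext h (Prod.ext (by linarith) (by linarith))

lemma card_filter_diffPrim_diffGcd_le (m : ℕ) (p : ℤ × ℤ) (g : ℕ) :
    (((latticeSet m).offDiag.filter fun q => diffPrim q = p).filter
      fun q => diffGcd q = g).card ≤ 2 := by
  rcases (((latticeSet m).offDiag.filter fun q => diffPrim q = p).filter
      fun q => diffGcd q = g).eq_empty_or_nonempty with h | ⟨q, hq⟩
  · simp [h]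
  · rw [Finset.mem_filter, Finset.mem_filter] at hq
    obtain ⟨⟨hq, rfl⟩, rfl⟩ := hq
    refine (Finset.card_le_card (t := {q, (-q.2, -q.1)}) fun q' hq' => ?_).trans Finset.card_le_two
    rw [Finset.mem_filter, Finset.mem_filter] at hq'
    obtain ⟨⟨hq', hp⟩, hg⟩ := hq'
    obtain ⟨b, h1, h2, h3⟩ := exists_sum_eq_rotation_diffPrim hq
    obtain ⟨b', h1', h2', h3'⟩ := exists_sum_eq_rotation_diffPrim hq'
    have e1 := diffGcd_mul_fst q
    have e2 := diffGcd_mul_snd q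
    have e1' := diffGcd_mul_fst q'
    have e2' := diffGcd_mul_snd q'
    rw [hp, hg] at h3' e1' e2'
    rw [hp] at h1' h2'
    have hpn := (isCoprime_diffPrim (Finset.mem_offDiag.1 hq).2.2).sq_add_sq_ne_zero
    have hbb : b' ^ 2 = b ^ 2 := by
      have := mul_left_cancel₀ hpn (h3'.trans h3.symm)
      linarith
    rw [Finset.mem_insert, Finset.mem_singleton]
    rcases sq_eq_sq_iff_eq_or_eq_neg.1 hbb with rfl | rfl
    · left
      exact Prod.ext (Prod.ext (by linarith) (by linarith)) (Prod.ext (by linarith) (by linarith))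
    · right
      exact Prod.ext (Prod.ext (by simp; linarith) (by simp; linarith))
        (Prod.ext (by simp; linarith) (by simp; linarith))

/-- The reciprocal distances between distinct lattice points on a circle sum to `O(N ^ ε)`. -/
lemma exists_sum_inv_dist_le {ε : ℝ} (hε : 0 < ε) :
    ∃ C > 0, ∀ m : ℕ, m ≠ 0 → 0 < latN m →
      ∑ q ∈ (latticeSet m).offDiag,
        (√(((q.1.1 - q.2.1 : ℤ) : ℝ) ^ 2 + ((q.1.2 - q.2.2 : ℤ) : ℝ) ^ 2))⁻¹ ≤
          C * (latN m : ℝ) ^ ε := by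
  obtain ⟨C, hC, h⟩ := exists_sum_primitive_le (half_pos hε)
  refine ⟨C * (3 + 2 / (ε / 2)), by positivity, fun m hm hN => ?_⟩
  set E := (latticeSet m).offDiag with hE
  have hN0 : (0 : ℝ) < latN m := by exact_mod_cast hN
  have hterm : ∀ q : (ℤ × ℤ) × (ℤ × ℤ),
      (√(((q.1.1 - q.2.1 : ℤ) : ℝ) ^ 2 + ((q.1.2 - q.2.2 : ℤ) : ℝ) ^ 2))⁻¹ =
        (√(((diffPrim q).1 : ℝ) ^ 2 + ((diffPrim q).2 : ℝ) ^ 2))⁻¹ * ((diffGcd q : ℝ))⁻¹ := by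
    intro q
    rw [diffGcd_mul_fst, diffGcd_mul_snd, ← mul_inv]
    push_cast
    rw [mul_pow, mul_pow, ← mul_add, Real.sqrt_mul (by positivity),
      Real.sqrt_sq (Nat.cast_nonneg _), mul_comm]
  have hprim : ∀ p ∈ E.image diffPrim,
      IsCoprime p.1 p.2 ∧ p.1 ^ 2 + p.2 ^ 2 ∣ 4 * (m : ℤ) := by
    intro p hp
    obtain ⟨q, hq, rfl⟩ := Finset.mem_image.1 hp
    obtain ⟨b, -, -, hb⟩ := exists_sum_eq_rotation_diffPrim hq
    exact ⟨isCoprime_diffPrim (Finset.mem_offDiag.1 hq).2.2, Dvd.intro _ hb⟩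
  calc _ = ∑ p ∈ E.image diffPrim, ∑ q ∈ E.filter fun q => diffPrim q = p,
        (√(((q.1.1 - q.2.1 : ℤ) : ℝ) ^ 2 + ((q.1.2 - q.2.2 : ℤ) : ℝ) ^ 2))⁻¹ := by
        rw [Finset.sum_fiberwise_of_maps_to fun q hq => Finset.mem_image_of_mem _ hq]
    _ ≤ ∑ p ∈ E.image diffPrim, (√((p.1 : ℝ) ^ 2 + (p.2 : ℝ) ^ 2))⁻¹ *
        ((3 + 2 / (ε / 2)) * (latN m : ℝ) ^ (ε / 2)) := by
        refine Finset.sum_le_sum fun p _ => ?_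
        rw [Finset.sum_congr rfl (g := fun q => (√((p.1 : ℝ) ^ 2 + (p.2 : ℝ) ^ 2))⁻¹ *
          ((diffGcd q : ℝ))⁻¹) fun q hq => by rw [hterm, (Finset.mem_filter.1 hq).2]]
        rw [← Finset.mul_sum]
        gcongr
        refine (sum_inv_le_harmonic _ diffGcd (latN m) (fun q hq => ?_)
          (card_filter_diffPrim_le m p) (card_filter_diffPrim_diffGcd_le m p)).trans
          (harmonic_le_rpow (half_pos hε) hN)
        exact diffGcd_pos (Finset.mem_offDiag.1 (Finset.mem_filter.1 hq).1).2.2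
    _ ≤ C * (latN m : ℝ) ^ (ε / 2) * ((3 + 2 / (ε / 2)) * (latN m : ℝ) ^ (ε / 2)) := by
        rw [← Finset.sum_mul]
        gcongr
        exact h m hm hN _ hprim
    _ = C * (3 + 2 / (ε / 2)) * ((latN m : ℝ) ^ (ε / 2) * (latN m : ℝ) ^ (ε / 2)) := by ring
    _ = C * (3 + 2 / (ε / 2)) * (latN m : ℝ) ^ ε := by
        rw [← Real.rpow_add hN0, add_halves]

lemma sum_latticeSet_mul_cos_eq_zero (m : ℕ) (p q u v : ℝ) :
    ∑ μ ∈ latticeSet m, (μ.1 * p + μ.2 * q) * Real.cos (2 * π * (μ.1 * u + μ.2 * v)) = 0 := by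
  have h : ∑ μ ∈ latticeSet m, (μ.1 * p + μ.2 * q) * Real.cos (2 * π * (μ.1 * u + μ.2 * v)) =
      ∑ μ ∈ latticeSet m, -((μ.1 * p + μ.2 * q) * Real.cos (2 * π * (μ.1 * u + μ.2 * v))) := by
    refine Finset.sum_nbij' (fun μ => -μ) (fun μ => -μ) ?_ ?_ (by simp) (by simp) ?_
    · intro μ hμ
      rw [mem_latticeSet] at hμ ⊢
      simpa using hμ
    · intro μ hμ
      rw [mem_latticeSet] at hμ ⊢
      simpa using hμ
    · intro μ _
      simp only [Prod.fst_neg, Prod.snd_neg, Int.cast_neg]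
      rw [show 2 * π * (-(μ.1 : ℝ) * u + -(μ.2 : ℝ) * v) = -(2 * π * (μ.1 * u + μ.2 * v)) by ring,
        Real.cos_neg]
      ring
  rw [Finset.sum_neg_distrib] at h
  linarith

lemma sum_latticeSet_inner_sq (m : ℕ) {p q : ℝ} (h : p ^ 2 + q ^ 2 = 1) :
    ∑ μ ∈ latticeSet m, ((μ.1 : ℝ) * p + μ.2 * q) ^ 2 = latN m * m / 2 := by
  have h1 : ∑ μ ∈ latticeSet m, ((μ.1 : ℝ) * p + μ.2 * q) ^ 2 =
      ∑ μ ∈ latticeSet m, (-(μ.2 : ℝ) * p + μ.1 * q) ^ 2 := by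
    refine Finset.sum_nbij' (fun μ => (μ.2, -μ.1)) (fun μ => (-μ.2, μ.1)) ?_ ?_ (by simp)
      (by simp) ?_
    · intro μ hμ
      rw [mem_latticeSet] at hμ ⊢
      simp only
      linarith
    · intro μ hμ
      rw [mem_latticeSet] at hμ ⊢
      simp only
      linarith
    · intro μ _
      push_cast
      ring
  have h2 : ∑ μ ∈ latticeSet m, ((μ.1 : ℝ) * p + μ.2 * q) ^ 2 +
      ∑ μ ∈ latticeSet m, (-(μ.2 : ℝ) * p + μ.1 * q) ^ 2 = latN m * m := by
    rw [← Finset.sum_add_distrib, Finset.sum_congr rfl (g := fun _ => (m : ℝ)) fun μ hμ => ?_,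
      Finset.sum_const, nsmul_eq_mul, latN]
    rw [mem_latticeSet] at hμ
    have hμ' : (μ.1 : ℝ) ^ 2 + (μ.2 : ℝ) ^ 2 = m := by exact_mod_cast hμ
    linear_combination ((μ.1 : ℝ) ^ 2 + (μ.2 : ℝ) ^ 2) * h + hμ'
  linarith

lemma covFn1_eq (m : ℕ) {γ : ℝ → ℝ × ℝ} (hγ : Differentiable ℝ γ) (t₁ t₂ : ℝ) :
    covFn1 m γ t₁ t₂ = -((latN m : ℝ)⁻¹ * (2 * π)) * ∑ μ ∈ latticeSet m,
      ((μ.1 : ℝ) * (deriv γ t₁).1 + μ.2 * (deriv γ t₁).2) *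
        Real.sin (2 * π * ((μ.1 : ℝ) * (γ t₁ - γ t₂).1 + (μ.2 : ℝ) * (γ t₁ - γ t₂).2)) := by
  have h1 : HasDerivAt (fun t => (γ t).1) (deriv γ t₁).1 t₁ := (hγ t₁).hasDerivAt.fst
  have h2 : HasDerivAt (fun t => (γ t).2) (deriv γ t₁).2 t₁ := (hγ t₁).hasDerivAt.snd
  refine HasDerivAt.deriv ?_
  unfold covFn
  rw [neg_mul, mul_assoc, ← mul_neg, Finset.mul_sum, ← Finset.sum_neg_distrib]
  refine HasDerivAt.const_mul _ (HasDerivAt.fun_sum fun μ _ => ?_)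
  refine HasDerivAt.congr_deriv
    ((((h1.sub_const (γ t₂).1).const_mul (μ.1 : ℝ)).add
      ((h2.sub_const (γ t₂).2).const_mul (μ.2 : ℝ))).const_mul (2 * π)).cos ?_
  simp only [Prod.fst_sub, Prod.snd_sub]
  simp
  ring

lemma sq_covFn1_div_eq {m : ℕ} {γ : ℝ → ℝ × ℝ} (hγ : Differentiable ℝ γ) (t₁ t₂ : ℝ) :
    (covFn1 m γ t₁ t₂ / (2 * π * √m)) ^ 2 = ((latN m : ℝ) ^ 2)⁻¹ *
      (∑ μ ∈ latticeSet m, ((μ.1 : ℝ) * (deriv γ t₁).1 + μ.2 * (deriv γ t₁).2) ^ 2 / m +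
       ∑ q ∈ (latticeSet m).offDiag,
        (q.1.1 / √m * (deriv γ t₁).1 + q.1.2 / √m * (deriv γ t₁).2) *
        (q.2.1 / √m * (deriv γ t₁).1 + q.2.2 / √m * (deriv γ t₁).2) *
        Real.cos (2 * π * (((q.1 - q.2).1 : ℝ) * (γ t₁).1 + ((q.1 - q.2).2 : ℝ) * (γ t₁).2) -
          2 * π * (((q.1 - q.2).1 : ℝ) * (γ t₂).1 + ((q.1 - q.2).2 : ℝ) * (γ t₂).2))) := by
  set a : ℤ × ℤ → ℝ := fun μ => (μ.1 : ℝ) * (deriv γ t₁).1 + μ.2 * (deriv γ t₁).2 with ha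
  set x : ℤ × ℤ → ℝ := fun μ =>
    2 * π * ((μ.1 : ℝ) * (γ t₁ - γ t₂).1 + (μ.2 : ℝ) * (γ t₁ - γ t₂).2) with hx
  have hcos : ∑ μ ∈ latticeSet m, a μ * Real.cos (x μ) = 0 :=
    sum_latticeSet_mul_cos_eq_zero m _ _ _ _
  have hsq : (∑ μ ∈ latticeSet m, a μ * Real.sin (x μ)) ^ 2 =
      ∑ μ ∈ latticeSet m, ∑ ν ∈ latticeSet m, a μ * a ν * Real.cos (x μ - x ν) := by
    have h : (∑ μ ∈ latticeSet m, a μ * Real.sin (x μ)) ^ 2 =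
        (∑ μ ∈ latticeSet m, a μ * Real.cos (x μ)) ^ 2 +
        (∑ μ ∈ latticeSet m, a μ * Real.sin (x μ)) ^ 2 := by rw [hcos]; ring
    rw [h, sq, sq, Finset.sum_mul_sum, Finset.sum_mul_sum, ← Finset.sum_add_distrib]
    refine Finset.sum_congr rfl fun μ _ => ?_
    rw [← Finset.sum_add_distrib]
    refine Finset.sum_congr rfl fun ν _ => ?_
    rw [Real.cos_sub]
    ring
  have hm : √(m : ℝ) ^ 2 = m := Real.sq_sqrt (Nat.cast_nonneg m)
  have hdecomp : (∑ μ ∈ latticeSet m, a μ * Real.sin (x μ)) ^ 2 =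
      ∑ μ ∈ latticeSet m, a μ ^ 2 +
        ∑ q ∈ (latticeSet m).offDiag, a q.1 * a q.2 * Real.cos (x q.1 - x q.2) := by
    rw [hsq, ← Finset.sum_product', ← Finset.diag_union_offDiag,
      Finset.sum_union (Finset.disjoint_diag_offDiag _), Finset.sum_diag]
    simp [sq]
  have hterm : ∀ q : (ℤ × ℤ) × (ℤ × ℤ),
      (q.1.1 / √m * (deriv γ t₁).1 + q.1.2 / √m * (deriv γ t₁).2) *
        (q.2.1 / √m * (deriv γ t₁).1 + q.2.2 / √m * (deriv γ t₁).2) *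
        Real.cos (2 * π * (((q.1 - q.2).1 : ℝ) * (γ t₁).1 + ((q.1 - q.2).2 : ℝ) * (γ t₁).2) -
          2 * π * (((q.1 - q.2).1 : ℝ) * (γ t₂).1 + ((q.1 - q.2).2 : ℝ) * (γ t₂).2)) =
      (a q.1 * a q.2 * Real.cos (x q.1 - x q.2)) / m := by
    intro q
    have hang : 2 * π * (((q.1 - q.2).1 : ℝ) * (γ t₁).1 + ((q.1 - q.2).2 : ℝ) * (γ t₁).2) -
        2 * π * (((q.1 - q.2).1 : ℝ) * (γ t₂).1 + ((q.1 - q.2).2 : ℝ) * (γ t₂).2) =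
        x q.1 - x q.2 := by
      simp only [hx, Prod.fst_sub, Prod.snd_sub]
      push_cast
      ring
    rw [hang]
    nth_rewrite 5 [← hm]
    simp only [ha]
    ring
  simp only [hterm]
  rw [← Finset.sum_div, ← Finset.sum_div, ← add_div]
  rw [← hdecomp, covFn1_eq m hγ, div_pow, mul_pow, mul_pow (2 * π), hm]
  have hpi : (2 * π) ≠ 0 := by positivity
  rw [neg_sq, mul_pow, inv_pow, mul_assoc, mul_div_assoc, mul_div_mul_left _ _ (pow_ne_zero 2 hpi)]

/-- Second moment of the normalized first derivative of the covariance function: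
`∫∫ (r₁/(2π√m))² = L²/(2N) + O(N^{ε−2})`. -/
theorem second_moment_covariance_deriv1
    (L : ℝ) (hL : 0 < L) (γ : ℝ → ℝ × ℝ) (hγ : ContDiff ℝ (⊤ : ℕ∞) γ)
    (hunit : ∀ t ∈ Set.Icc (0:ℝ) L, (deriv γ t).1 ^ 2 + (deriv γ t).2 ^ 2 = 1)
    (hcurv : ∀ t ∈ Set.Icc (0:ℝ) L, deriv (deriv γ) t ≠ 0) :
    ∀ ε > (0:ℝ), ∃ C > 0, ∀ m : ℕ, 0 < m →
      (∃ a b : ℤ, a ^ 2 + b ^ 2 = (m : ℤ)) →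
      |(∫ t₁ in (0:ℝ)..L, ∫ t₂ in (0:ℝ)..L,
            (covFn1 m γ t₁ t₂ / (2 * π * Real.sqrt m)) ^ 2)
          - L ^ 2 / (2 * latN m)|
        ≤ C * (latN m : ℝ) ^ (ε - 2) := by
  intro ε hε
  obtain ⟨C₁, hC₁, h₁⟩ := exists_abs_integral_curve_le hL hγ hunit hcurv
  obtain ⟨C₂, hC₂, h₂⟩ := exists_sum_inv_dist_le hε
  refine ⟨C₁ * C₂, by positivity, fun m hm hsum => ?_⟩
  obtain ⟨x, y, hxy⟩ := hsum
  have hN : 0 < latN m := Finset.card_pos.2 ⟨(x, y), mem_latticeSet.2 hxy⟩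
  have hN0 : (0 : ℝ) < latN m := by exact_mod_cast hN
  have hm0 : (0 : ℝ) < m := by exact_mod_cast hm
  have hdγ : Differentiable ℝ γ := (contDiff_infty_iff_deriv.1 hγ).1
  have hγc : Continuous γ := hγ.continuous
  have hγ'c : Continuous (deriv γ) := (contDiff_infty_iff_deriv.1 hγ).2.continuous
  set F : (ℤ × ℤ) × (ℤ × ℤ) → ℝ → ℝ → ℝ := fun q t₁ t₂ =>
    (q.1.1 / √m * (deriv γ t₁).1 + q.1.2 / √m * (deriv γ t₁).2) *
      (q.2.1 / √m * (deriv γ t₁).1 + q.2.2 / √m * (deriv γ t₁).2) *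
      Real.cos (2 * π * (((q.1 - q.2).1 : ℝ) * (γ t₁).1 + ((q.1 - q.2).2 : ℝ) * (γ t₁).2) -
        2 * π * (((q.1 - q.2).1 : ℝ) * (γ t₂).1 + ((q.1 - q.2).2 : ℝ) * (γ t₂).2)) with hF
  have hFc : ∀ q, Continuous (Function.uncurry (F q)) := by
    intro q
    simp only [hF, Function.uncurry_def]
    fun_prop
  have hinner : ∀ t₁ ∈ Set.uIcc (0:ℝ) L, (∫ t₂ in (0:ℝ)..L,
      (covFn1 m γ t₁ t₂ / (2 * π * √m)) ^ 2) = ((latN m : ℝ) ^ 2)⁻¹ *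
        (L * (latN m / 2) + ∑ q ∈ (latticeSet m).offDiag, ∫ t₂ in (0:ℝ)..L, F q t₁ t₂) := by
    intro t₁ ht₁
    rw [Set.uIcc_of_le hL.le] at ht₁
    have hd : ∑ μ ∈ latticeSet m, ((μ.1 : ℝ) * (deriv γ t₁).1 + μ.2 * (deriv γ t₁).2) ^ 2 / m =
        latN m / 2 := by
      rw [← Finset.sum_div, sum_latticeSet_inner_sq m (hunit t₁ ht₁)]
      field_simp
    have hc : ∀ q, Continuous (F q t₁) := fun q =>
      (hFc q).comp (Continuous.prodMk_right t₁)
    simp only [sq_covFn1_div_eq hdγ, hd]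
    rw [intervalIntegral.integral_const_mul, intervalIntegral.integral_add
      (by simp) ((continuous_finsetSum _ fun q _ => hc q).intervalIntegrable _ _),
      intervalIntegral.integral_finsetSum fun q _ => (hc q).intervalIntegrable _ _,
      intervalIntegral.integral_const, smul_eq_mul, sub_zero]
  have houter : (∫ t₁ in (0:ℝ)..L, ∫ t₂ in (0:ℝ)..L,
      (covFn1 m γ t₁ t₂ / (2 * π * √m)) ^ 2) = ((latN m : ℝ) ^ 2)⁻¹ *
        (L * (L * (latN m / 2)) + ∑ q ∈ (latticeSet m).offDiag,
          ∫ t₁ in (0:ℝ)..L, ∫ t₂ in (0:ℝ)..L, F q t₁ t₂) := by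
    have hc : ∀ q, Continuous fun t₁ => ∫ t₂ in (0:ℝ)..L, F q t₁ t₂ := fun q =>
      intervalIntegral.continuous_parametric_intervalIntegral_of_continuous' (hFc q) 0 L
    rw [intervalIntegral.integral_congr hinner, intervalIntegral.integral_const_mul,
      intervalIntegral.integral_add
      (by simp) ((continuous_finsetSum _ fun q _ => hc q).intervalIntegrable _ _),
      intervalIntegral.integral_finsetSum fun q _ => (hc q).intervalIntegrable _ _,
      intervalIntegral.integral_const, smul_eq_mul, sub_zero]
  have hunitvec : ∀ μ ∈ latticeSet m,
      ((μ.1 / √m : ℝ)) ^ 2 + ((μ.2 / √m : ℝ)) ^ 2 ≤ 1 := by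
    intro μ hμ
    rw [mem_latticeSet] at hμ
    have hμ' : (μ.1 : ℝ) ^ 2 + (μ.2 : ℝ) ^ 2 = m := by exact_mod_cast hμ
    rw [div_pow, div_pow, ← add_div, hμ', Real.sq_sqrt hm0.le, div_self hm0.ne']
  have hoff : |∑ q ∈ (latticeSet m).offDiag, ∫ t₁ in (0:ℝ)..L, ∫ t₂ in (0:ℝ)..L, F q t₁ t₂| ≤
      C₁ * (C₂ * (latN m : ℝ) ^ ε) := by
    refine (Finset.abs_sum_le_sum_abs _ _).trans ?_
    refine le_trans (Finset.sum_le_sum fun q hq => ?_)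
      (((Finset.mul_sum _ _ C₁).symm.le).trans
        (mul_le_mul_of_nonneg_left (h₂ m hm.ne' hN) hC₁.le))
    rw [Finset.mem_offDiag] at hq
    exact h₁ (q.1 - q.2) (sub_ne_zero.2 hq.2.2) (q.1.1 / √m, q.1.2 / √m)
      (q.2.1 / √m, q.2.2 / √m) (hunitvec _ hq.1) (hunitvec _ hq.2.1)
  have hdiff : (∫ t₁ in (0:ℝ)..L, ∫ t₂ in (0:ℝ)..L,
      (covFn1 m γ t₁ t₂ / (2 * π * √m)) ^ 2) - L ^ 2 / (2 * latN m) =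
      ((latN m : ℝ) ^ 2)⁻¹ * ∑ q ∈ (latticeSet m).offDiag,
          ∫ t₁ in (0:ℝ)..L, ∫ t₂ in (0:ℝ)..L, F q t₁ t₂ := by
    rw [houter, mul_add, add_sub_right_comm, add_eq_right]
    field_simp
    ring
  rw [hdiff, abs_mul, abs_of_pos (by positivity), Real.rpow_sub hN0, Real.rpow_two]
  calc _ ≤ ((latN m : ℝ) ^ 2)⁻¹ * (C₁ * (C₂ * (latN m : ℝ) ^ ε)) := by gcongr
    _ = _ := by ring

end
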